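/- Let a > 0, L ≥ 1 and let g ∈ C²(ℝ) satisfy min_{x∈[−2a,2a]} g(x) = 4La, and set G := {(x,y) : x ∈ (−a,a), g(x) − La < y ≤ g(x)}. Then for every 0 < p ≤ ∞, every λ > 1 and all nonnegative integers r, i, j, there is a constant c > 0 (independent of f and n) such that for every n ∈ ℕ and every f ∈ Π_n²: ‖ φ_n^i · D^{(r)} ∂₂^{i+j} f ‖_{L^p(G)} ≤ c · n^{r+i+2j} · ‖f‖_{L^p(G(λ))}. -/

import Mathlib

open MeasureTheory Set
open scoped ENNReal

noncomputable section

/-- Partial derivative `∂₁ = ∂/∂x` of a function on `ℝ²`. -/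
def pd1 (f : ℝ × ℝ → ℝ) : ℝ × ℝ → ℝ := fun p => deriv (fun t => f (t, p.2)) p.1

/-- Partial derivative `∂₂ = ∂/∂y` of a function on `ℝ²`. -/
def pd2 (f : ℝ × ℝ → ℝ) : ℝ × ℝ → ℝ := fun p => deriv (fun t => f (p.1, t)) p.2

/-- The tangential derivative frozen at `x₀`:
`D_{x₀}^ℓ f = Σ_{i=0}^ℓ binom(ℓ,i) (g′(x₀))^i ∂₁^{ℓ−i} ∂₂^i f`. -/
def DtanAt (g : ℝ → ℝ) (x₀ : ℝ) (ℓ : ℕ) (f : ℝ × ℝ → ℝ) : ℝ × ℝ → ℝ :=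
  fun p => ∑ i ∈ Finset.range (ℓ + 1),
    (ℓ.choose i : ℝ) * deriv g x₀ ^ i * (pd1^[ℓ - i] (pd2^[i] f)) p

/-- The `ℓ`-th order tangential differential operator `D^{(ℓ)} f(x,y) = (D_x^ℓ f)(x,y)`. -/
def Dtan (g : ℝ → ℝ) (ℓ : ℕ) (f : ℝ × ℝ → ℝ) : ℝ × ℝ → ℝ :=
  fun p => DtanAt g p.1 ℓ f p

/-- `f` is (the evaluation of) a real polynomial in two variables of total degree at most `n`. -/
def IsPoly2 (n : ℕ) (f : ℝ × ℝ → ℝ) : Prop :=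
  ∃ P : MvPolynomial (Fin 2) ℝ, P.totalDegree ≤ n ∧
    ∀ p : ℝ × ℝ, f p = MvPolynomial.eval ![p.1, p.2] P

/-- The set `G(λ) = {(x,y) : x ∈ (−λa,λa), g(x) − λLa < y ≤ g(x)}`; `G = G(1)`. -/
def Gset (a L : ℝ) (g : ℝ → ℝ) (lam : ℝ) : Set (ℝ × ℝ) :=
  {p | p.1 ∈ Set.Ioo (-(lam * a)) (lam * a) ∧ g p.1 - lam * L * a < p.2 ∧ p.2 ≤ g p.1}

/-- `φ_n(x,y) = √(g(x) − y) + 1/n`. -/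
def phi2 (g : ℝ → ℝ) (n : ℕ) (p : ℝ × ℝ) : ℝ := Real.sqrt (g p.1 - p.2) + 1 / n

/-- `U` is dominated on the closed unit disc by the modulus of a function holomorphic in the disc
and continuous up to the boundary, with equality on the unit circle. -/
def HasHolomorphicMajorant (U : ℂ → ℝ) : Prop :=
  ∃ E : ℂ → ℂ, DiffContOnCl ℂ E (Metric.ball 0 1) ∧ (∀ w, ‖w‖ ≤ 1 → U w ≤ ‖E w‖) ∧
    ∀ w, ‖w‖ = 1 → U w = ‖E w‖

lemma HasHolomorphicMajorant.mul {U V : ℂ → ℝ} (hU : HasHolomorphicMajorant U)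
    (hV : HasHolomorphicMajorant V) (hV₀ : ∀ w, 0 ≤ V w) :
    HasHolomorphicMajorant (fun w => U w * V w) := by
  obtain ⟨E, hE, hle, heq⟩ := hU
  obtain ⟨F, hF, hle', heq'⟩ := hV
  refine ⟨fun w => E w • F w, hE.smul hF, fun w hw => ?_, fun w hw => ?_⟩
  · rw [norm_smul]
    exact mul_le_mul (hle w hw) (hle' w hw) (hV₀ w) (norm_nonneg _)
  · simp only [norm_smul, heq w hw, heq' w hw]

lemma hasHolomorphicMajorant_const {c : ℝ} (hc : 0 ≤ c) :
    HasHolomorphicMajorant (fun _ => c) :=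
  ⟨fun _ => (c : ℂ), diffContOnCl_const, by simp [abs_of_nonneg hc], by simp [abs_of_nonneg hc]⟩

lemma diffContOnCl_one_sub_mul_cpow {b : ℂ} (hb : ‖b‖ ≤ 1) {p : ℝ} (hp : 0 < p) :
    DiffContOnCl ℂ (fun w => (1 - b * w) ^ (p : ℂ)) (Metric.ball 0 1) := by
  constructor
  · refine DifferentiableOn.cpow_const (by fun_prop) fun w hw => ?_
    left
    rw [mem_ball_zero_iff] at hw
    have h1 : (b * w).re ≤ ‖b * w‖ := Complex.re_le_norm _
    have h2 : ‖b * w‖ < 1 := by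
      rw [norm_mul]
      nlinarith [norm_nonneg w, norm_nonneg b]
    simp only [Complex.sub_re, Complex.one_re]
    linarith
  · rw [closure_ball _ one_ne_zero]
    intro w hw
    rw [mem_closedBall_zero_iff] at hw
    have h1 : (b * w).re ≤ ‖b * w‖ := Complex.re_le_norm _
    have h2 : ‖b * w‖ ≤ 1 := by
      rw [norm_mul]
      nlinarith [norm_nonneg w, norm_nonneg b]
    have h3 : ContinuousAt (fun z : ℂ => z ^ (p : ℂ)) (1 - b * w) := by
      apply Complex.continuousAt_cpow_const_of_re_pos
      · left
        simp only [Complex.sub_re, Complex.one_re]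
        linarith
      · simpa using hp
    exact (ContinuousAt.comp (f := fun w => 1 - b * w) h3 (by fun_prop)).continuousWithinAt

lemma hasHolomorphicMajorant_norm_sub_rpow (a : ℂ) {p : ℝ} (hp : 0 < p) :
    HasHolomorphicMajorant (fun w => ‖w - a‖ ^ p) := by
  rcases le_or_gt ‖a‖ 1 with ha | ha
  · have key : ∀ w : ℂ, ‖1 - (starRingEnd ℂ) a * w‖ ^ 2 - ‖w - a‖ ^ 2
        = (1 - ‖a‖ ^ 2) * (1 - ‖w‖ ^ 2) := by
      intro w
      simp only [← Complex.normSq_eq_norm_sq, Complex.normSq_apply, Complex.sub_re,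
        Complex.sub_im, Complex.mul_re, Complex.mul_im, Complex.conj_re, Complex.conj_im,
        Complex.one_re, Complex.one_im]
      ring
    refine ⟨_, diffContOnCl_one_sub_mul_cpow (b := (starRingEnd ℂ) a) (by simpa using ha) hp,
      fun w hw => ?_, fun w hw => ?_⟩
    · rw [Complex.norm_cpow_real]
      refine Real.rpow_le_rpow (norm_nonneg _) ?_ hp.le
      refine (sq_le_sq₀ (norm_nonneg _) (norm_nonneg _)).1 ?_
      have := key w
      have h2 : 0 ≤ (1 - ‖a‖ ^ 2) * (1 - ‖w‖ ^ 2) := by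
        apply mul_nonneg <;> nlinarith [norm_nonneg a, norm_nonneg w]
      linarith
    · rw [Complex.norm_cpow_real]
      have h2 : ‖w - a‖ = ‖1 - (starRingEnd ℂ) a * w‖ := by
        refine (sq_eq_sq₀ (norm_nonneg _) (norm_nonneg _)).1 ?_
        have := key w
        rw [hw] at this
        linarith
      simp only [h2]
  · have ha0 : a ≠ 0 := by
      rintro rfl
      simp at ha
      linarith
    have key : ∀ w : ℂ, ‖w - a‖ ^ p = ‖((‖a‖ ^ p : ℝ) : ℂ) • (1 - a⁻¹ * w) ^ (p : ℂ)‖ := by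
      intro w
      rw [norm_smul, Complex.norm_cpow_real, Complex.norm_real, Real.norm_of_nonneg (by positivity),
        ← Real.mul_rpow (norm_nonneg _) (norm_nonneg _), ← norm_mul, mul_sub,
        mul_inv_cancel_left₀ ha0, mul_one, norm_sub_rev]
    refine ⟨_, (diffContOnCl_const (c := ((‖a‖ ^ p : ℝ) : ℂ))).smul
      (diffContOnCl_one_sub_mul_cpow (b := a⁻¹) ?_ hp), fun w _ => (key w).le, fun w _ => key w⟩
    rw [norm_inv]
    exact inv_le_one_of_one_le₀ ha.le

lemma hasHolomorphicMajorant_norm_eval_rpow (h : Polynomial ℂ) {p : ℝ} (hp : 0 < p) :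
    HasHolomorphicMajorant (fun w => ‖h.eval w‖ ^ p) := by
  have hroots : ∀ s : Multiset ℂ, HasHolomorphicMajorant
      (fun w => ‖((s.map fun x => Polynomial.X - Polynomial.C x).prod).eval w‖ ^ p) := by
    intro s
    induction s using Multiset.induction_on with
    | empty => simpa using hasHolomorphicMajorant_const zero_le_one
    | cons a s ih =>
      simp only [Multiset.map_cons, Multiset.prod_cons, Polynomial.eval_mul, norm_mul,
        Real.mul_rpow (norm_nonneg _) (norm_nonneg _), Polynomial.eval_sub, Polynomial.eval_X,
        Polynomial.eval_C]
      exact (hasHolomorphicMajorant_norm_sub_rpow a hp).mul ih fun w => by positivity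
  rw [(IsAlgClosed.splits h).eq_prod_roots]
  simp only [Polynomial.eval_mul, norm_mul, Real.mul_rpow (norm_nonneg _) (norm_nonneg _),
    Polynomial.eval_C]
  exact (hasHolomorphicMajorant_const (by positivity)).mul (hroots _) fun w => by positivity

/-- The Poisson density at the angle `α` seen from the point `w` of the unit disc. -/
def poissonDensity (w : ℂ) (α : ℝ) : ℝ :=
  (2 * Real.pi)⁻¹ * ((1 - ‖w‖ ^ 2) / ‖circleMap 0 1 α - w‖ ^ 2)

lemma poissonDensity_nonneg {w : ℂ} (hw : ‖w‖ < 1) (α : ℝ) : 0 ≤ poissonDensity w α := by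
  have : 0 ≤ 1 - ‖w‖ ^ 2 := by nlinarith [norm_nonneg w]
  unfold poissonDensity
  positivity

lemma norm_circleMap_one_sub_pos {w : ℂ} (hw : ‖w‖ < 1) (α : ℝ) : 0 < ‖circleMap 0 1 α - w‖ := by
  rw [norm_pos_iff, sub_ne_zero]
  rintro rfl
  simp at hw

lemma continuous_poissonDensity {X : Type*} [TopologicalSpace X] {f : X → ℂ} {g : X → ℝ}
    (hf : Continuous f) (hg : Continuous g) (hf1 : ∀ x, ‖f x‖ < 1) :
    Continuous (fun x => poissonDensity (f x) (g x)) := by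
  unfold poissonDensity
  have h1 : Continuous fun x => circleMap 0 1 (g x) := (continuous_circleMap 0 1).comp hg
  exact continuous_const.mul (Continuous.div (by fun_prop) (by fun_prop)
    fun x => (pow_pos (norm_circleMap_one_sub_pos (hf1 x) _) 2).ne')

lemma lintegral_poissonDensity_mul {E : ℂ → ℂ} (hE : DiffContOnCl ℂ E (Metric.ball 0 1))
    {w : ℂ} (hw : ‖w‖ < 1) :
    ‖E w‖ₑ ≤ ∫⁻ α in Ioc 0 (2 * Real.pi),
      ENNReal.ofReal (poissonDensity w α) * ‖E (circleMap 0 1 α)‖ₑ := by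
  rw [← hE.circleAverage_poissonKernel_smul (w := w) (by simpa using hw), Real.circleAverage,
    intervalIntegral.integral_of_le Real.two_pi_pos.le, ← integral_smul]
  refine (enorm_integral_le_lintegral_enorm _).trans (lintegral_mono fun α => ?_)
  simp only [Pi.smul_apply', enorm_smul]
  rw [← mul_assoc, ← enorm_mul]
  gcongr
  rw [← ofReal_norm, Real.norm_of_nonneg]
  · simp [poissonDensity, poissonKernel]
  · have := poissonDensity_nonneg hw α
    simpa [poissonDensity, poissonKernel] using this

lemma lintegral_poissonDensity {w : ℂ} (hw : ‖w‖ < 1) :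
    ∫⁻ α in Ioc 0 (2 * Real.pi), ENNReal.ofReal (poissonDensity w α) = 1 := by
  have h := (diffContOnCl_const : DiffContOnCl ℂ (fun _ : ℂ => (1 : ℂ))
    (Metric.ball 0 1)).circleAverage_poissonKernel_smul (w := w) (by simpa using hw)
  have hc : Continuous (poissonDensity w) :=
    continuous_poissonDensity continuous_const continuous_id fun _ => hw
  rw [← ofReal_integral_eq_lintegral_ofReal
    (hc.integrableOn_Icc.mono_set Ioc_subset_Icc_self)
    (Filter.Eventually.of_forall fun α => poissonDensity_nonneg hw α), ENNReal.ofReal_eq_one,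
    ← intervalIntegral.integral_of_le Real.two_pi_pos.le]
  simp only [Real.circleAverage, Pi.smul_apply', intervalIntegral.integral_smul_const] at h
  rw [← smul_assoc, Complex.real_smul, mul_one, Complex.ofReal_eq_one] at h
  rw [← h]
  simp [poissonDensity, poissonKernel]

lemma HasHolomorphicMajorant.le_lintegral {U : ℂ → ℝ} (hU : HasHolomorphicMajorant U)
    {w : ℂ} (hw : ‖w‖ < 1) :
    ENNReal.ofReal (U w) ≤ ∫⁻ α in Ioc 0 (2 * Real.pi),
      ENNReal.ofReal (poissonDensity w α) * ENNReal.ofReal (U (circleMap 0 1 α)) := by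
  obtain ⟨E, hE, hle, heq⟩ := hU
  calc ENNReal.ofReal (U w) ≤ ‖E w‖ₑ := by
        rw [← ofReal_norm]
        exact ENNReal.ofReal_le_ofReal (hle w hw.le)
    _ ≤ _ := lintegral_poissonDensity_mul hE hw
    _ = _ := by simp_rw [heq (circleMap 0 1 _) (by simp), ofReal_norm]

/-- The law of the angle reached from the boundary point `1` by a Poisson jump to the circle of
radius `1 + 2 / N`, a reflection into the unit disc and a second Poisson jump to the unit circle. -/
def angleMeasure (N : ℕ) : Measure ℝ :=
  Measure.map (fun x : ℝ × ℝ => -x.2)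
    (((volume.restrict (Ioc 0 (2 * Real.pi))).prod
      (volume.restrict (Ioc 0 (2 * Real.pi)))).withDensity fun x =>
        ENNReal.ofReal (poissonDensity ((1 + 2 / N : ℝ)⁻¹ : ℝ) x.1) *
          ENNReal.ofReal (poissonDensity (((1 + 2 / N : ℝ)⁻¹ : ℝ) * circleMap 0 1 (-x.1)) x.2))

lemma one_add_two_div_inv_lt_one {N : ℕ} (hN : 0 < N) : (1 + 2 / N : ℝ)⁻¹ < 1 := by
  have : (0 : ℝ) < 2 / N := by positivity
  exact inv_lt_one_of_one_lt₀ (by linarith)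

lemma lintegral_angleMeasure {N : ℕ} (hN : 0 < N) {F : ℝ → ℝ≥0∞} (hF : Measurable F) :
    ∫⁻ β, F β ∂angleMeasure N = ∫⁻ α in Ioc 0 (2 * Real.pi),
      ENNReal.ofReal (poissonDensity ((1 + 2 / N : ℝ)⁻¹ : ℝ) α) *
        ∫⁻ β in Ioc 0 (2 * Real.pi),
          ENNReal.ofReal (poissonDensity (((1 + 2 / N : ℝ)⁻¹ : ℝ) * circleMap 0 1 (-α)) β) *
            F (-β) := by
  have hlt := one_add_two_div_inv_lt_one hN
  have h0 : (0 : ℝ) < (1 + 2 / N : ℝ)⁻¹ := by positivity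
  have hn1 : ‖(((1 + 2 / N : ℝ)⁻¹ : ℝ) : ℂ)‖ < 1 := by
    rw [Complex.norm_real, Real.norm_of_nonneg h0.le]
    exact hlt
  have hn2 : ∀ α, ‖(((1 + 2 / N : ℝ)⁻¹ : ℝ) : ℂ) * circleMap 0 1 α‖ < 1 := by
    intro α
    simpa [norm_mul] using hn1
  have hc : Continuous fun α : ℝ => circleMap 0 1 α := continuous_circleMap 0 1
  have m1 : Measurable fun x : ℝ × ℝ =>
      ENNReal.ofReal (poissonDensity (((1 + 2 / N : ℝ)⁻¹ : ℝ) : ℂ) x.1) :=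
    (continuous_poissonDensity continuous_const continuous_fst fun _ => hn1).measurable.ennreal_ofReal
  have m2 : Measurable fun x : ℝ × ℝ => ENNReal.ofReal
      (poissonDensity ((((1 + 2 / N : ℝ)⁻¹ : ℝ) : ℂ) * circleMap 0 1 (-x.1)) x.2) :=
    (continuous_poissonDensity (by fun_prop) continuous_snd fun _ => hn2 _).measurable.ennreal_ofReal
  have m12 : Measurable fun x : ℝ × ℝ =>
      ENNReal.ofReal (poissonDensity (((1 + 2 / N : ℝ)⁻¹ : ℝ) : ℂ) x.1) * ENNReal.ofReal
        (poissonDensity ((((1 + 2 / N : ℝ)⁻¹ : ℝ) : ℂ) * circleMap 0 1 (-x.1)) x.2) := m1.mul m2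
  rw [angleMeasure, lintegral_map hF (by fun_prop),
    lintegral_withDensity_eq_lintegral_mul _ m12 (by fun_prop), lintegral_prod _
    (m12.mul (by fun_prop)).aemeasurable]
  refine lintegral_congr fun α => ?_
  rw [← lintegral_const_mul]
  · refine lintegral_congr fun β => ?_
    simp [mul_assoc]
  · exact (m2.comp measurable_prodMk_left).mul (by fun_prop)

lemma angleMeasure_univ {N : ℕ} (hN : 0 < N) : angleMeasure N univ = 1 := by
  have hlt := one_add_two_div_inv_lt_one hN
  have h0 : (0 : ℝ) < (1 + 2 / N : ℝ)⁻¹ := by positivity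
  have hn1 : ‖(((1 + 2 / N : ℝ)⁻¹ : ℝ) : ℂ)‖ < 1 := by
    rw [Complex.norm_real, Real.norm_of_nonneg h0.le]
    exact hlt
  have hn2 : ∀ α, ‖(((1 + 2 / N : ℝ)⁻¹ : ℝ) : ℂ) * circleMap 0 1 α‖ < 1 := by
    intro α
    simpa [norm_mul] using hn1
  rw [← lintegral_one, lintegral_angleMeasure hN measurable_const]
  simp only [mul_one, lintegral_poissonDensity (hn2 _), lintegral_poissonDensity hn1]

lemma poissonDensity_div_le {N : ℕ} (hN : 0 < N) {w : ℂ} (hw : ‖w - 1‖ ≤ 1 / N) (α : ℝ) :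
    poissonDensity (((1 + 2 / N : ℝ)⁻¹ : ℝ) * w) α ≤
      6 * poissonDensity ((1 + 2 / N : ℝ)⁻¹ : ℝ) α := by
  have hlt := one_add_two_div_inv_lt_one hN
  set x : ℝ := 1 / N with hx
  have hx0 : 0 < x := by positivity
  have hx1 : x ≤ 1 := by
    rw [hx, div_le_one (by positivity)]
    exact_mod_cast hN
  have h2 : (2 / N : ℝ) = 2 * x := by rw [hx]; ring
  rw [h2] at hlt ⊢
  set ρ : ℝ := (1 + 2 * x)⁻¹ with hρ
  have hρ0 : 0 < ρ := by positivity
  have hρR : ρ * (1 + 2 * x) = 1 := inv_mul_cancel₀ (by positivity)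
  have hn1 : ‖(ρ : ℂ)‖ = ρ := by rw [Complex.norm_real, Real.norm_of_nonneg hρ0.le]
  have hwu : ‖w‖ ≤ 1 + x := by
    have := norm_add_le (w - 1) 1
    simp at this
    linarith
  have hwl : 1 - x ≤ ‖w‖ := by
    have := norm_sub_norm_le (1 : ℂ) w
    rw [norm_sub_rev, norm_one] at this
    linarith
  have hw1 : ‖(ρ : ℂ) * w‖ < 1 := by
    rw [norm_mul, hn1]
    nlinarith
  have hd := norm_circleMap_one_sub_pos hw1 α
  have hd1 := norm_circleMap_one_sub_pos (w := (ρ : ℂ)) (by rwa [hn1]) α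
  set e := circleMap 0 1 α
  have he : ‖e‖ = 1 := by simp [e]
  have hlow : ρ * x ≤ ‖e - ρ * w‖ := by
    have := norm_sub_norm_le e (ρ * w)
    rw [he, norm_mul, hn1] at this
    nlinarith
  have hup : ‖e - ρ‖ ≤ 2 * ‖e - ρ * w‖ := by
    have h3 := norm_add_le (e - ρ * w) (ρ * (w - 1))
    have h4 : e - ρ * w + ρ * (w - 1) = e - ρ := by ring
    rw [h4, norm_mul, hn1] at h3
    nlinarith
  unfold poissonDensity
  rw [mul_left_comm]
  refine mul_le_mul_of_nonneg_left ?_ (by positivity)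
  rw [mul_div_assoc', div_le_div_iff₀ (by positivity) (by positivity)]
  have hnum : 1 - ‖(ρ : ℂ) * w‖ ^ 2 ≤ 3 / 2 * (1 - ‖(ρ : ℂ)‖ ^ 2) := by
    rw [norm_mul, hn1]
    have h5 : (1 - x) ^ 2 ≤ ‖w‖ ^ 2 := by
      apply pow_le_pow_left₀ (by linarith) hwl
    have h6 : 3 / 2 * (1 - ρ ^ 2) - (1 - (ρ * ‖w‖) ^ 2)
        = ρ ^ 2 * (1 / 2 * (1 + 2 * x) ^ 2 - 3 / 2 + ‖w‖ ^ 2) := by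
      have : (1 : ℝ) = ρ ^ 2 * (1 + 2 * x) ^ 2 := by rw [← mul_pow, hρR, one_pow]
      linear_combination (1 / 2 : ℝ) * this
    have h7 : 0 ≤ 1 / 2 * (1 + 2 * x) ^ 2 - 3 / 2 + ‖w‖ ^ 2 := by nlinarith
    nlinarith [mul_nonneg (sq_nonneg ρ) h7]
  have hnn : 0 ≤ 1 - ‖(ρ : ℂ)‖ ^ 2 := by rw [hn1]; nlinarith
  calc (1 - ‖(ρ : ℂ) * w‖ ^ 2) * ‖e - ρ‖ ^ 2
      ≤ (3 / 2 * (1 - ‖(ρ : ℂ)‖ ^ 2)) * (2 * ‖e - ρ * w‖) ^ 2 := by gcongr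
    _ = _ := by ring

lemma norm_eval_reflect {h : Polynomial ℂ} {N : ℕ} (hh : h.natDegree ≤ N) {z : ℂ} (hz : z ≠ 0) :
    ‖h.eval z‖ = ‖z‖ ^ N * ‖(h.reflect N).eval z⁻¹‖ := by
  let _ := invertibleOfNonzero hz
  have := Polynomial.eval₂_reflect_mul_pow (RingHom.id ℂ) z N h hh
  rw [invOf_eq_inv] at this
  change (h.reflect N).eval z⁻¹ * z ^ N = h.eval z at this
  rw [← this, norm_mul, norm_pow, mul_comm]

lemma hasHolomorphicMajorant_pair (h k : Polynomial ℂ) {p q : ℝ} (hp : 0 < p) (hq : 0 < q) :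
    HasHolomorphicMajorant (fun w => ‖h.eval w‖ ^ p * ‖k.eval w‖ ^ q) :=
  (hasHolomorphicMajorant_norm_eval_rpow h hp).mul (hasHolomorphicMajorant_norm_eval_rpow k hq)
    fun w => by positivity

/-- Near the point `1` of the unit circle, `|h|^p |k|^q` is controlled by an average over the unit
circle which depends only on the degree of the polynomials. -/
lemma ofReal_norm_eval_near_one_le {p q : ℝ} (hp : 0 < p) (hq : 0 < q) {N : ℕ} (hN : 0 < N)
    {h k : Polynomial ℂ} (hh : h.natDegree ≤ N) (hk : k.natDegree ≤ N) {w : ℂ}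
    (hw : ‖w - 1‖ ≤ 1 / N) :
    ENNReal.ofReal (‖h.eval w‖ ^ p * ‖k.eval w‖ ^ q) ≤
      ENNReal.ofReal (6 * Real.exp (2 * (p + q))) * ∫⁻ β,
        ENNReal.ofReal (‖h.eval (circleMap 0 1 β)‖ ^ p * ‖k.eval (circleMap 0 1 β)‖ ^ q)
          ∂angleMeasure N := by
  have hlt := one_add_two_div_inv_lt_one hN
  have hdens := poissonDensity_div_le hN hw
  have hcont : ∀ f : Polynomial ℂ, Continuous fun w => f.eval w := fun f => f.continuous
  have hmeas : Measurable fun β => ENNReal.ofReal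
      (‖h.eval (circleMap 0 1 β)‖ ^ p * ‖k.eval (circleMap 0 1 β)‖ ^ q) := by
    have := hcont h
    have := hcont k
    have := continuous_circleMap 0 1
    refine (Continuous.measurable ?_).ennreal_ofReal
    refine Continuous.mul ?_ ?_ <;>
    exact Continuous.rpow_const (by fun_prop) fun _ => Or.inr (by positivity)
  rw [lintegral_angleMeasure hN hmeas]
  set R : ℝ := 1 + 2 / N with hR
  have hR1 : 1 < R := by
    have : (0 : ℝ) < 2 / N := by positivity
    linarith
  have hR0 : 0 < R := by linarith
  have hR0' : (R : ℂ) ≠ 0 := by exact_mod_cast hR0.ne'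
  have hRN : R ^ N ≤ Real.exp 2 := by
    have h1 : R ≤ Real.exp (2 / N) := by
      have := Real.add_one_le_exp (2 / N : ℝ)
      linarith
    calc R ^ N ≤ Real.exp (2 / N) ^ N := pow_le_pow_left₀ hR0.le h1 N
      _ = Real.exp 2 := by
        rw [← Real.exp_nat_mul]
        congr 1
        field_simp
  have hw1 : ‖((R⁻¹ : ℝ) : ℂ) * w‖ < 1 := by
    have hwu : ‖w‖ ≤ 1 + 1 / N := by
      have := norm_add_le (w - 1) 1
      simp at this
      simp only [one_div] at hw ⊢
      linarith
    rw [norm_mul, Complex.norm_real, Real.norm_of_nonneg (by positivity), inv_mul_lt_iff₀ hR0,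
      mul_one]
    have : (0 : ℝ) < 1 / N := by positivity
    have h2 : (2 / N : ℝ) = 2 * (1 / N) := by ring
    rw [hR, h2]
    linarith
  have hRinv : ‖((R⁻¹ : ℝ) : ℂ)‖ < 1 := by
    rw [Complex.norm_real, Real.norm_of_nonneg (by positivity)]
    exact hlt
  have hscale : ∀ (f : Polynomial ℂ) (z : ℂ),
      (f.comp (Polynomial.C (R : ℂ) * Polynomial.X)).eval z = f.eval (R * z) := by
    intro f z
    simp
  have step1 := (hasHolomorphicMajorant_pair (h.comp (Polynomial.C (R : ℂ) * Polynomial.X))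
    (k.comp (Polynomial.C (R : ℂ) * Polynomial.X)) hp hq).le_lintegral hw1
  simp only [hscale] at step1
  have hRw : (R : ℂ) * (((R⁻¹ : ℝ) : ℂ) * w) = w := by
    rw [Complex.ofReal_inv, mul_inv_cancel_left₀ hR0']
  rw [hRw] at step1
  have step2 : ∀ α : ℝ, ENNReal.ofReal
      (‖h.eval (R * circleMap 0 1 α)‖ ^ p * ‖k.eval (R * circleMap 0 1 α)‖ ^ q) ≤
      ENNReal.ofReal (Real.exp (2 * (p + q))) * ∫⁻ β in Ioc 0 (2 * Real.pi),
        ENNReal.ofReal (poissonDensity ((R⁻¹ : ℝ) * circleMap 0 1 (-α)) β) *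
          ENNReal.ofReal (‖h.eval (circleMap 0 1 (-β))‖ ^ p *
            ‖k.eval (circleMap 0 1 (-β))‖ ^ q) := by
    intro α
    have hz : (R : ℂ) * circleMap 0 1 α ≠ 0 := mul_ne_zero hR0' (by simp [circleMap])
    have hzi : ((R : ℂ) * circleMap 0 1 α)⁻¹ = ((R⁻¹ : ℝ) : ℂ) * circleMap 0 1 (-α) := by
      rw [mul_inv, Complex.ofReal_inv, circleMap_zero_inv]
      simp
    have hzn : ‖(R : ℂ) * circleMap 0 1 α‖ = R := by
      simp [abs_of_pos hR0]
    have hin : ‖((R⁻¹ : ℝ) : ℂ) * circleMap 0 1 (-α)‖ < 1 := by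
      simpa [norm_mul] using hRinv
    have hle := (hasHolomorphicMajorant_pair (h.reflect N) (k.reflect N) hp hq).le_lintegral hin
    have hunit : ∀ (f : Polynomial ℂ), f.natDegree ≤ N → ∀ β : ℝ,
        ‖(f.reflect N).eval (circleMap 0 1 β)‖ = ‖f.eval (circleMap 0 1 (-β))‖ := by
      intro f hf β
      rw [norm_eval_reflect hf (z := circleMap 0 1 (-β)) (by simp [circleMap]),
        circleMap_zero_inv]
      simp
    simp only [hunit h hh, hunit k hk] at hle
    rw [norm_eval_reflect hh hz, norm_eval_reflect hk hz, hzi, hzn]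
    have hfac : (R ^ N * ‖(h.reflect N).eval (((R⁻¹ : ℝ) : ℂ) * circleMap 0 1 (-α))‖) ^ p *
        (R ^ N * ‖(k.reflect N).eval (((R⁻¹ : ℝ) : ℂ) * circleMap 0 1 (-α))‖) ^ q ≤
        Real.exp (2 * (p + q)) *
        (‖(h.reflect N).eval (((R⁻¹ : ℝ) : ℂ) * circleMap 0 1 (-α))‖ ^ p *
          ‖(k.reflect N).eval (((R⁻¹ : ℝ) : ℂ) * circleMap 0 1 (-α))‖ ^ q) := by
      rw [Real.mul_rpow (by positivity) (norm_nonneg _),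
        Real.mul_rpow (by positivity) (norm_nonneg _), mul_mul_mul_comm,
        ← Real.rpow_add (by positivity)]
      refine mul_le_mul_of_nonneg_right ?_ (by positivity)
      rw [Real.exp_mul]
      exact Real.rpow_le_rpow (by positivity) hRN (by positivity)
    refine (ENNReal.ofReal_le_ofReal hfac).trans ?_
    rw [ENNReal.ofReal_mul (Real.exp_pos _).le]
    gcongr
  refine step1.trans ?_
  rw [ENNReal.ofReal_mul (by norm_num), mul_assoc, ← lintegral_const_mul' _ _ (by simp),
    ← lintegral_const_mul' _ _ (by simp)]
  refine lintegral_mono fun α => ?_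
  calc _ ≤ ENNReal.ofReal (6 * poissonDensity ((R⁻¹ : ℝ) : ℂ) α) * _ :=
        mul_le_mul' (ENNReal.ofReal_le_ofReal (hdens α)) (step2 α)
    _ = _ := by
      rw [ENNReal.ofReal_mul (by norm_num)]
      ring

/-- Rotated version of `ofReal_norm_eval_near_one_le`. -/
lemma ofReal_norm_eval_near_circle_le {p q : ℝ} (hp : 0 < p) (hq : 0 < q) {N : ℕ} (hN : 0 < N)
    {h k : Polynomial ℂ} (hh : h.natDegree ≤ N) (hk : k.natDegree ≤ N) {w : ℂ} {θ : ℝ}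
    (hw : ‖w - circleMap 0 1 θ‖ ≤ 1 / N) :
    ENNReal.ofReal (‖h.eval w‖ ^ p * ‖k.eval w‖ ^ q) ≤
      ENNReal.ofReal (6 * Real.exp (2 * (p + q))) * ∫⁻ β,
        ENNReal.ofReal (‖h.eval (circleMap 0 1 (θ + β))‖ ^ p *
          ‖k.eval (circleMap 0 1 (θ + β))‖ ^ q) ∂angleMeasure N := by
  set e := circleMap 0 1 θ
  have he0 : e ≠ 0 := by simp [e, circleMap]
  have he1 : ‖e‖ = 1 := by simp [e]
  have hdeg : ∀ f : Polynomial ℂ, f.natDegree ≤ N →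
      (f.comp (Polynomial.C e * Polynomial.X)).natDegree ≤ N := by
    intro f hf
    refine Polynomial.natDegree_comp_le.trans ?_
    calc f.natDegree * (Polynomial.C e * Polynomial.X).natDegree ≤ f.natDegree * 1 :=
          Nat.mul_le_mul_left _ ((Polynomial.natDegree_C_mul_le e _).trans Polynomial.natDegree_X_le)
      _ ≤ N := by simpa using hf
  have hw' : ‖e⁻¹ * w - 1‖ ≤ 1 / N := by
    have : e⁻¹ * w - 1 = e⁻¹ * (w - e) := by field_simp
    rw [this, norm_mul, norm_inv, he1]
    simpa using hw
  have hrot : ∀ β, e * circleMap 0 1 β = circleMap 0 1 (θ + β) := by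
    intro β
    simp [e, circleMap, add_mul, Complex.exp_add]
  have := ofReal_norm_eval_near_one_le hp hq hN (hdeg h hh) (hdeg k hk) hw'
  simpa [mul_inv_cancel_left₀ he0, hrot] using this

/-- Points close to `cos θ` have a preimage close to `e^{iθ}` under the Joukowski map. -/
lemma exists_joukowski_preimage {N θ : ℝ} (hN : 1 ≤ N) {z : ℂ}
    (hz : ‖z - Real.cos θ‖ ≤ 1 / 32 * (|Real.sin θ| / N + 1 / N ^ 2)) :
    ∃ w : ℂ, w ≠ 0 ∧ (w + w⁻¹) / 2 = z ∧ ‖w - circleMap 0 1 θ‖ ≤ 1 / N := by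
  obtain ⟨s, hs⟩ := IsAlgClosed.exists_pow_nat_eq (z ^ 2 - 1) (n := 2) two_pos
  set e := circleMap 0 1 θ with he
  set e' := circleMap 0 1 (-θ) with he'
  have hee : e * e' = 1 := by
    simp [he, he', circleMap, ← Complex.exp_add]
  have hsum : e + e' = 2 * Real.cos θ := by
    simp [he, he', circleMap, Complex.ofReal_cos, Complex.cos]
    ring
  have hdiff : ‖e - e'‖ = 2 * |Real.sin θ| := by
    have : e - e' = ((2 * Real.sin θ : ℝ) : ℂ) * Complex.I := by
      simp [he, he', circleMap, Complex.ofReal_sin, Complex.sin]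
      linear_combination (Complex.exp (θ * Complex.I) - Complex.exp (-(θ * Complex.I))) *
        Complex.I_sq
    rw [this, norm_mul, Complex.norm_I, mul_one, Complex.norm_real, Real.norm_eq_abs, abs_mul,
      abs_two]
  have hroot : ∃ w v : ℂ, w * v = 1 ∧ w + v = 2 * z ∧ ‖w - e‖ ≤ ‖w - e'‖ := by
    have h1 : (z + s) * (z - s) = 1 := by linear_combination -hs
    rcases le_total ‖z + s - e‖ ‖z + s - e'‖ with h | h
    · exact ⟨z + s, z - s, h1, by ring, h⟩
    · refine ⟨z - s, z + s, by linear_combination h1, by ring, ?_⟩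
      have h2 : z - s - e = -(e * (z - s)) * (z + s - e') := by
        linear_combination e * h1 - (z - s) * hee
      have h3 : z - s - e' = -(e' * (z - s)) * (z + s - e) := by
        linear_combination e' * h1 - (z - s) * hee
      have h4 : ‖e‖ = 1 := by simp [he]
      have h5 : ‖e'‖ = 1 := by simp [he']
      rw [h2, h3, norm_mul, norm_mul, norm_neg, norm_neg, norm_mul, norm_mul, h4, h5]
      exact mul_le_mul_of_nonneg_left h (by positivity)
  obtain ⟨w, v, hwv, hwz, hAB⟩ := hroot
  have hw0 : w ≠ 0 := left_ne_zero_of_mul_eq_one hwv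
  have hv : v = w⁻¹ := eq_inv_of_mul_eq_one_right hwv
  refine ⟨w, hw0, by rw [← hv, hwz]; ring, ?_⟩
  have hprod : ‖w - e‖ * ‖w - e'‖ = 2 * ‖z - Real.cos θ‖ * ‖w‖ := by
    have : (w - e) * (w - e') = 2 * (z - Real.cos θ) * w := by
      linear_combination hee - hwv - w * hsum + w * hwz
    rw [← norm_mul, this, norm_mul, norm_mul]
    simp
  have hBs : 2 * |Real.sin θ| ≤ ‖w - e‖ + ‖w - e'‖ := by
    rw [← hdiff]
    have := norm_sub_le (w - e') (w - e)
    have h2 : w - e' - (w - e) = e - e' := by ring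
    rw [h2] at this
    linarith
  have hwn : ‖w‖ ≤ 1 + ‖w - e‖ := by
    have := norm_add_le (w - e) e
    have h4 : ‖e‖ = 1 := by simp [he]
    rw [sub_add_cancel, h4] at this
    linarith
  have hσ := Real.abs_sin_le_one θ
  have hσ0 := abs_nonneg (Real.sin θ)
  generalize ‖w - e‖ = A at *
  generalize ‖w - e'‖ = B at *
  generalize |Real.sin θ| = σ at *
  have hx0 : 0 < 1 / N := by positivity
  have hx1 : 1 / N ≤ 1 := by rw [div_le_one (by positivity)]; exact hN
  rw [div_eq_mul_one_div σ N, ← one_div_pow] at hz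
  generalize 1 / N = x at *
  have hη0 : 0 ≤ ‖z - Real.cos θ‖ := norm_nonneg _
  generalize ‖z - Real.cos θ‖ = η at *
  have hw00 := norm_nonneg w
  generalize ‖w‖ = W at *
  by_cases hA : A ≤ 0
  · linarith
  push Not at hA
  have hη : η ≤ 1 / 16 := by nlinarith
  have hA1 : A ≤ 1 := by
    by_contra! h
    nlinarith
  have hW2 : W ≤ 2 := by linarith
  have hAA : A * A ≤ 4 * η := by nlinarith
  have hAσ : A * σ ≤ 4 * η := by nlinarith
  rcases le_total x σ with h | h
  · have : A * σ ≤ x * σ := by nlinarith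
    exact le_of_mul_le_mul_right this (by linarith)
  · have : A * A ≤ x * x := by nlinarith
    nlinarith

/-- The polynomial `w ^ n * Q ((w + w⁻¹) / 2)`. -/
def joukowskiPoly (n : ℕ) (Q : Polynomial ℂ) : Polynomial ℂ :=
  ∑ k ∈ Finset.range (n + 1), Polynomial.C (Q.coeff k * (1 / 2) ^ k) *
    ((Polynomial.X ^ 2 + 1) ^ k * Polynomial.X ^ (n - k))

lemma natDegree_joukowskiPoly_le (n : ℕ) (Q : Polynomial ℂ) :
    (joukowskiPoly n Q).natDegree ≤ 2 * n := by
  refine Polynomial.natDegree_sum_le_of_forall_le _ _ fun k hk => ?_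
  have hk' : k ≤ n := by simpa [Nat.lt_succ_iff] using hk
  refine (Polynomial.natDegree_C_mul_le _ _).trans (Polynomial.natDegree_mul_le.trans ?_)
  have h1 : (Polynomial.X ^ 2 + 1 : Polynomial ℂ).natDegree ≤ 2 := by compute_degree
  have h2 := Polynomial.natDegree_pow_le (p := (Polynomial.X ^ 2 + 1 : Polynomial ℂ)) (n := k)
  rw [Polynomial.natDegree_X_pow]
  have h3 : k * (Polynomial.X ^ 2 + 1 : Polynomial ℂ).natDegree ≤ k * 2 := Nat.mul_le_mul_left _ h1
  omega

lemma eval_joukowskiPoly {n : ℕ} {Q : Polynomial ℂ} (hQ : Q.natDegree ≤ n) {w : ℂ} (hw : w ≠ 0) :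
    (joukowskiPoly n Q).eval w = w ^ n * Q.eval ((w + w⁻¹) / 2) := by
  rw [Polynomial.eval_eq_sum_range' (Nat.lt_succ_of_le hQ), joukowskiPoly,
    Polynomial.eval_finsetSum, Finset.mul_sum]
  refine Finset.sum_congr rfl fun k hk => ?_
  have hk' : k ≤ n := by simpa [Nat.lt_succ_iff] using hk
  have h1 : w ^ n = w ^ k * w ^ (n - k) := by rw [← pow_add]; congr 1; omega
  have h2 : (w + w⁻¹) / 2 * w = 1 / 2 * (w ^ 2 + 1) := by field_simp
  simp only [Polynomial.eval_mul, Polynomial.eval_C, Polynomial.eval_pow, Polynomial.eval_add,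
    Polynomial.eval_X, Polynomial.eval_one]
  calc Q.coeff k * (1 / 2) ^ k * ((w ^ 2 + 1) ^ k * w ^ (n - k))
      = Q.coeff k * (1 / 2 * (w ^ 2 + 1)) ^ k * w ^ (n - k) := by rw [mul_pow]; ring
    _ = _ := by rw [← h2, h1, mul_pow]; ring

/-- Near a point `cos θ` of `[-1, 1]`, `|Q|^p` times a power of `√|z² - 1|` is controlled by an
average of `|Q|^p` over `[-1, 1]`. -/
lemma ofReal_norm_eval_near_cos_le {p : ℝ} (hp : 0 < p) {e : ℕ} (he : e ≤ 1) {n : ℕ} (hn : 0 < n)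
    {Q : Polynomial ℂ} (hQ : Q.natDegree ≤ n) {z : ℂ} {θ : ℝ}
    (hz : ‖z - Real.cos θ‖ ≤
      1 / 32 * (|Real.sin θ| / ((2 * n : ℕ) : ℝ) + 1 / ((2 * n : ℕ) : ℝ) ^ 2)) :
    ENNReal.ofReal (‖Q.eval z‖ ^ p * √‖z ^ 2 - 1‖ ^ e) ≤
      ENNReal.ofReal (2 ^ p * 12 * Real.exp (2 * (p + 1))) * ∫⁻ β,
        ENNReal.ofReal (‖Q.eval (Real.cos (θ + β) : ℂ)‖ ^ p * |Real.sin (θ + β)| ^ e)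
          ∂angleMeasure (2 * n) := by
  have hN : 0 < 2 * n := by omega
  have hn1 : (1 : ℝ) ≤ n := by exact_mod_cast hn
  obtain ⟨w, hw0, rfl, hw⟩ := exists_joukowski_preimage (by exact_mod_cast hN) hz
  have hwl : 1 - 1 / ((2 * n : ℕ) : ℝ) ≤ ‖w‖ := by
    have := norm_sub_norm_le (circleMap 0 1 θ) w
    rw [norm_sub_rev] at this
    simp only [norm_circleMap_zero, abs_one] at this
    linarith
  have hx : 1 / ((2 * n : ℕ) : ℝ) ≤ 1 / 2 := by
    push_cast
    rw [div_le_div_iff₀ (by positivity) (by positivity)]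
    linarith
  have hw2 : 1 / 2 ≤ ‖w‖ := by linarith
  have hwn : 1 / 2 ≤ ‖w‖ ^ n := by
    have h1 := one_add_mul_le_pow (a := -(1 / ((2 * n : ℕ) : ℝ))) (by linarith) n
    have h2 : 1 + n * -(1 / ((2 * n : ℕ) : ℝ)) = 1 / 2 := by
      push_cast
      field_simp
      norm_num
    rw [h2] at h1
    exact h1.trans (pow_le_pow_left₀ (by linarith) (by linarith) n)
  set K : Polynomial ℂ := (Polynomial.X ^ 2 - 1) ^ e with hK
  have hKdeg : K.natDegree ≤ 2 * n := by
    have h1 : (Polynomial.X ^ 2 - 1 : Polynomial ℂ).natDegree ≤ 2 := by compute_degree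
    have h2 := Polynomial.natDegree_pow_le (p := (Polynomial.X ^ 2 - 1 : Polynomial ℂ)) (n := e)
    have h3 := Nat.mul_le_mul he h1
    rw [← hK] at h2
    omega
  have hKeval : ∀ v : ℂ, ‖K.eval v‖ ^ (1 : ℝ) = ‖v ^ 2 - 1‖ ^ e := by
    intro v
    simp [hK]
  have main := ofReal_norm_eval_near_circle_le hp one_pos hN (natDegree_joukowskiPoly_le n Q)
    hKdeg hw
  simp only [hKeval] at main
  have hcirc : ∀ φ : ℝ, ‖(joukowskiPoly n Q).eval (circleMap 0 1 φ)‖ ^ p *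
      ‖circleMap 0 1 φ ^ 2 - 1‖ ^ e ≤
      2 * (‖Q.eval (Real.cos φ : ℂ)‖ ^ p * |Real.sin φ| ^ e) := by
    intro φ
    have h0 : circleMap 0 1 φ ≠ 0 := by simp [circleMap]
    have h1 : (circleMap 0 1 φ + (circleMap 0 1 φ)⁻¹) / 2 = (Real.cos φ : ℂ) := by
      rw [circleMap_zero_inv]
      simp [circleMap, Complex.ofReal_cos, Complex.cos]
    have h2 : ‖circleMap 0 1 φ ^ 2 - 1‖ = 2 * |Real.sin φ| := by
      have h3 : circleMap 0 1 φ ^ 2 - 1 =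
          circleMap 0 1 φ * (((2 * Real.sin φ : ℝ) : ℂ) * Complex.I) := by
        simp only [circleMap, Complex.exp_mul_I]
        push_cast
        have h4 := Complex.sin_sq_add_cos_sq (φ : ℂ)
        linear_combination (-Complex.sin (φ : ℂ) ^ 2) * Complex.I_sq + h4
      rw [h3, norm_mul, norm_mul, Complex.norm_I, mul_one, Complex.norm_real, Real.norm_eq_abs,
        abs_mul, abs_two, norm_circleMap_zero, abs_one, one_mul]
    rw [eval_joukowskiPoly hQ h0, h1, h2, norm_mul, norm_pow, mul_pow]
    simp only [norm_circleMap_zero, abs_one, one_pow, one_mul]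
    have h5 : (2 : ℝ) ^ e ≤ 2 := by
      simpa using pow_le_pow_right₀ (one_le_two : (1 : ℝ) ≤ 2) he
    have h6 : 0 ≤ ‖Q.eval (Real.cos φ : ℂ)‖ ^ p * |Real.sin φ| ^ e := by positivity
    nlinarith
  have hleft : ‖Q.eval ((w + w⁻¹) / 2)‖ ^ p * √‖((w + w⁻¹) / 2) ^ 2 - 1‖ ^ e ≤
      2 ^ p * (‖(joukowskiPoly n Q).eval w‖ ^ p * ‖w ^ 2 - 1‖ ^ e) := by
    rw [eval_joukowskiPoly hQ hw0, ← mul_assoc, ← Real.mul_rpow two_pos.le (norm_nonneg _)]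
    gcongr
    · rw [norm_mul, norm_pow, ← mul_assoc]
      have := norm_nonneg (Q.eval ((w + w⁻¹) / 2))
      nlinarith
    · refine Real.sqrt_le_iff.2 ⟨norm_nonneg _, ?_⟩
      have h1 : (w ^ 2 - 1) ^ 2 = 4 * w ^ 2 * (((w + w⁻¹) / 2) ^ 2 - 1) := by
        field_simp
        ring
      rw [← norm_pow, h1, norm_mul, norm_mul, norm_pow]
      have h2 : (1 : ℝ) ≤ ‖(4 : ℂ)‖ * ‖w‖ ^ 2 := by
        rw [Complex.norm_ofNat]
        nlinarith
      nlinarith [norm_nonneg (((w + w⁻¹) / 2) ^ 2 - 1)]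
  refine (ENNReal.ofReal_le_ofReal hleft).trans ?_
  rw [ENNReal.ofReal_mul (by positivity)]
  calc _ ≤ ENNReal.ofReal (2 ^ p) * (ENNReal.ofReal (6 * Real.exp (2 * (p + 1))) * ∫⁻ β,
        ENNReal.ofReal 2 * ENNReal.ofReal (‖Q.eval (Real.cos (θ + β) : ℂ)‖ ^ p *
          |Real.sin (θ + β)| ^ e) ∂angleMeasure (2 * n)) := by
        refine mul_le_mul_right (main.trans (mul_le_mul_right (lintegral_mono fun β => ?_) _)) _
        rw [← ENNReal.ofReal_mul two_pos.le]
        exact ENNReal.ofReal_le_ofReal (hcirc _)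
    _ = _ := by
      rw [lintegral_const_mul' _ _ (by simp), ← mul_assoc, ← mul_assoc,
        ← ENNReal.ofReal_mul (by positivity), ← ENNReal.ofReal_mul (by positivity)]
      congr 2
      ring

/-- Two-variable version of `ofReal_norm_eval_near_cos_le`, near the origin in the first
variable and near `cos θ` in the second one. -/
lemma ofReal_norm_near_cos_le_lintegral_lintegral {p : ℝ} (hp : 0 < p) {e : ℕ} (he : e ≤ 1) {n : ℕ}
    (hn : 0 < n) {Ψ : ℂ → ℂ → ℂ}
    (hΨ₁ : ∀ z, ∃ Q : Polynomial ℂ, Q.natDegree ≤ 2 * n ∧ ∀ t, Ψ t z = Q.eval t)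
    (hΨ₂ : ∀ t, ∃ Q : Polynomial ℂ, Q.natDegree ≤ n ∧ ∀ z, Ψ t z = Q.eval z)
    {δ : ℝ} (hδ : 0 < δ) {t z : ℂ} {θ : ℝ} (ht : ‖t‖ ≤ δ / (128 * n))
    (hz : ‖z - Real.cos θ‖ ≤
      1 / 32 * (|Real.sin θ| / ((2 * n : ℕ) : ℝ) + 1 / ((2 * n : ℕ) : ℝ) ^ 2)) :
    ENNReal.ofReal (‖Ψ t z‖ ^ p * √‖z ^ 2 - 1‖ ^ e) ≤
      ENNReal.ofReal ((2 ^ p * 12 * Real.exp (2 * (p + 1))) ^ 2) * ∫⁻ β, ∫⁻ τ,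
        ENNReal.ofReal (‖Ψ ((δ * Real.cos (Real.pi / 2 + τ) : ℝ) : ℂ) (Real.cos (θ + β) : ℂ)‖ ^ p *
          |Real.sin (θ + β)| ^ e) ∂angleMeasure (2 * (2 * n)) ∂angleMeasure (2 * n) := by
  have hn1 : (1 : ℝ) ≤ n := by exact_mod_cast hn
  set K := 2 ^ p * 12 * Real.exp (2 * (p + 1)) with hK
  have hK0 : 0 ≤ K := by positivity
  have h1 : ∀ v : ℂ, ENNReal.ofReal (‖Ψ t v‖ ^ p) ≤ ENNReal.ofReal K * ∫⁻ τ,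
      ENNReal.ofReal (‖Ψ ((δ * Real.cos (Real.pi / 2 + τ) : ℝ) : ℂ) v‖ ^ p)
        ∂angleMeasure (2 * (2 * n)) := by
    intro v
    obtain ⟨Q, hQ, hQe⟩ := hΨ₁ v
    have hδ0 : (δ : ℂ) ≠ 0 := by exact_mod_cast hδ.ne'
    have hdeg : (Q.comp (Polynomial.C (δ : ℂ) * Polynomial.X)).natDegree ≤ 2 * n := by
      refine Polynomial.natDegree_comp_le.trans ?_
      have : (Polynomial.C (δ : ℂ) * Polynomial.X).natDegree ≤ 1 := by compute_degree
      nlinarith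
    have hv : ‖t / δ - Real.cos (Real.pi / 2)‖ ≤ 1 / 32 * (|Real.sin (Real.pi / 2)| /
        ((2 * (2 * n) : ℕ) : ℝ) + 1 / ((2 * (2 * n) : ℕ) : ℝ) ^ 2) := by
      rw [Real.cos_pi_div_two, Real.sin_pi_div_two, abs_one, Complex.ofReal_zero, sub_zero,
        norm_div, Complex.norm_real, Real.norm_of_nonneg hδ.le]
      have h2 : ‖t‖ / δ ≤ 1 / (128 * n) := by
        rw [div_le_iff₀ hδ]
        calc _ ≤ _ := ht
          _ = _ := by ring
      have h3 : 1 / (128 * n : ℝ) = 1 / 32 * (1 / ((2 * (2 * n) : ℕ) : ℝ)) := by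
        push_cast
        field_simp
        norm_num
      have h4 : 0 ≤ 1 / ((2 * (2 * n) : ℕ) : ℝ) ^ 2 := by positivity
      linarith
    have main := ofReal_norm_eval_near_cos_le hp zero_le_one (by omega : 0 < 2 * n) hdeg hv
    simp only [Polynomial.eval_comp, Polynomial.eval_mul, Polynomial.eval_C, Polynomial.eval_X,
      mul_div_cancel₀ t hδ0, pow_zero, mul_one, ← hQe] at main
    simpa only [Complex.ofReal_mul] using main
  obtain ⟨Q, hQ, hQe⟩ := hΨ₂ t
  have main := ofReal_norm_eval_near_cos_le hp he hn hQ hz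
  simp only [← hQe] at main
  refine main.trans ?_
  rw [← hK, pow_two, ENNReal.ofReal_mul hK0, mul_assoc (ENNReal.ofReal K),
    ← lintegral_const_mul' (ENNReal.ofReal K) (fun β => ∫⁻ τ, _ ∂_) ENNReal.ofReal_ne_top]
  refine mul_le_mul_right (lintegral_mono fun β => ?_) _
  rw [ENNReal.ofReal_mul (by positivity)]
  refine (mul_le_mul_left (h1 _) _).trans_eq ?_
  rw [mul_assoc, ← lintegral_mul_const' _ _ ENNReal.ofReal_ne_top]
  congr 2
  ext τ
  rw [ENNReal.ofReal_mul (by positivity)]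

/-- The derivation `∂₀ + s ∂₁` on polynomials in two variables. -/
def tangentPDeriv {R : Type*} [CommRing R] (s : R) : Module.End R (MvPolynomial (Fin 2) R) :=
  (MvPolynomial.pderiv 0).toLinearMap + s • (MvPolynomial.pderiv 1).toLinearMap

lemma hasDerivAt_eval_line {𝕜 : Type*} [NontriviallyNormedField 𝕜] (P : MvPolynomial (Fin 2) 𝕜)
    (c v : Fin 2 → 𝕜) (t : 𝕜) :
    HasDerivAt (fun t => MvPolynomial.eval (c + t • v) P)
      (v 0 * MvPolynomial.eval (c + t • v) (MvPolynomial.pderiv 0 P) +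
        v 1 * MvPolynomial.eval (c + t • v) (MvPolynomial.pderiv 1 P)) t := by
  induction P using MvPolynomial.induction_on with
  | C a => simpa using hasDerivAt_const t a
  | add p q hp hq =>
    simp only [map_add]
    exact (hp.add hq).congr_deriv (by ring)
  | mul_X p i hp =>
    have h : HasDerivAt (fun t => (c + t • v) i) (v i) t := by
      simpa using ((hasDerivAt_id t).mul_const (v i)).const_add (c i)
    simp only [map_mul, MvPolynomial.eval_X]
    refine (hp.mul h).congr_deriv ?_
    fin_cases i <;> simp [MvPolynomial.pderiv_X] <;> ring

lemma pd1_eval (P : MvPolynomial (Fin 2) ℝ) :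
    pd1 (fun q => MvPolynomial.eval ![q.1, q.2] P) =
      fun q => MvPolynomial.eval ![q.1, q.2] (MvPolynomial.pderiv 0 P) := by
  ext q
  have := (hasDerivAt_eval_line P ![0, q.2] ![1, 0] q.1).deriv
  simpa [pd1] using this

lemma pd2_eval (P : MvPolynomial (Fin 2) ℝ) :
    pd2 (fun q => MvPolynomial.eval ![q.1, q.2] P) =
      fun q => MvPolynomial.eval ![q.1, q.2] (MvPolynomial.pderiv 1 P) := by
  ext q
  have := (hasDerivAt_eval_line P ![q.1, 0] ![0, 1] q.2).deriv
  simpa [pd2] using this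

lemma iterate_pd1_eval (k : ℕ) (P : MvPolynomial (Fin 2) ℝ) :
    pd1^[k] (fun q => MvPolynomial.eval ![q.1, q.2] P) =
      fun q => MvPolynomial.eval ![q.1, q.2]
        (((MvPolynomial.pderiv 0).toLinearMap ^ k : Module.End ℝ (MvPolynomial (Fin 2) ℝ)) P) := by
  induction k with
  | zero => rfl
  | succ k ih => rw [Function.iterate_succ_apply', ih, pd1_eval, pow_succ']; rfl

lemma iterate_pd2_eval (k : ℕ) (P : MvPolynomial (Fin 2) ℝ) :
    pd2^[k] (fun q => MvPolynomial.eval ![q.1, q.2] P) =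
      fun q => MvPolynomial.eval ![q.1, q.2]
        (((MvPolynomial.pderiv 1).toLinearMap ^ k : Module.End ℝ (MvPolynomial (Fin 2) ℝ)) P) := by
  induction k with
  | zero => rfl
  | succ k ih => rw [Function.iterate_succ_apply', ih, pd2_eval, pow_succ']; rfl

lemma commute_pderiv_one_zero : Commute ((MvPolynomial.pderiv 1).toLinearMap :
    Module.End ℝ (MvPolynomial (Fin 2) ℝ)) (MvPolynomial.pderiv 0).toLinearMap := by
  refine LinearMap.ext fun Q => ?_
  have h : ⁅(MvPolynomial.pderiv 1 : Derivation ℝ (MvPolynomial (Fin 2) ℝ) _),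
      (MvPolynomial.pderiv 0 : Derivation ℝ (MvPolynomial (Fin 2) ℝ) _)⁆ = 0 := by
    ext i
    fin_cases i <;> simp [Derivation.commutator_apply, MvPolynomial.pderiv_X]
  have := DFunLike.congr_fun h Q
  rw [Derivation.commutator_apply] at this
  exact sub_eq_zero.1 this

lemma Dtan_eval (g : ℝ → ℝ) (r : ℕ) (P : MvPolynomial (Fin 2) ℝ) (q : ℝ × ℝ) :
    Dtan g r (fun q => MvPolynomial.eval ![q.1, q.2] P) q =
      MvPolynomial.eval ![q.1, q.2] ((tangentPDeriv (deriv g q.1) ^ r) P) := by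
  rw [tangentPDeriv, add_comm, (commute_pderiv_one_zero.smul_left (deriv g q.1)).add_pow, LinearMap.sum_apply, map_sum]
  simp only [Dtan, DtanAt]
  refine Finset.sum_congr rfl fun i _ => ?_
  rw [iterate_pd2_eval, iterate_pd1_eval, smul_pow, smul_mul_assoc, ← nsmul_eq_mul',
    (commute_pderiv_one_zero.pow_pow _ _).eq]
  simp
  ring

lemma map_tangentPDeriv_pow (s : ℝ) (r : ℕ) (P : MvPolynomial (Fin 2) ℝ) :
    MvPolynomial.map (algebraMap ℝ ℂ) ((tangentPDeriv s ^ r) P) =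
      (tangentPDeriv (s : ℂ) ^ r) (MvPolynomial.map (algebraMap ℝ ℂ) P) := by
  induction r generalizing P with
  | zero => rfl
  | succ r ih =>
    rw [pow_succ, pow_succ, Module.End.mul_apply, Module.End.mul_apply, ih]
    congr 1
    simp [tangentPDeriv, MvPolynomial.pderiv_map, MvPolynomial.smul_eq_C_mul]

lemma map_pderiv_pow (r : ℕ) (P : MvPolynomial (Fin 2) ℝ) :
    MvPolynomial.map (algebraMap ℝ ℂ)
      (((MvPolynomial.pderiv 1).toLinearMap ^ r : Module.End ℝ (MvPolynomial (Fin 2) ℝ)) P) =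
      ((MvPolynomial.pderiv 1).toLinearMap ^ r : Module.End ℂ (MvPolynomial (Fin 2) ℂ))
        (MvPolynomial.map (algebraMap ℝ ℂ) P) := by
  induction r generalizing P with
  | zero => rfl
  | succ r ih =>
    rw [pow_succ, pow_succ, Module.End.mul_apply, Module.End.mul_apply, ih]
    congr 1
    simp [MvPolynomial.pderiv_map]

/-- Cauchy's estimates for iterates of a derivation acting as the derivative along a line. -/
lemma norm_eval_pow_le_of_line {D : Module.End ℂ (MvPolynomial (Fin 2) ℂ)} {c v : Fin 2 → ℂ}
    (hD : ∀ (P : MvPolynomial (Fin 2) ℂ) (t : ℂ), HasDerivAt (fun t : ℂ => MvPolynomial.eval (c + t • v) P)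
      (MvPolynomial.eval (c + t • v) (D P)) t) (P : MvPolynomial (Fin 2) ℂ) (k : ℕ) {R M : ℝ}
    (hR : 0 < R) (hM : ∀ t : ℂ, ‖t‖ = R → ‖MvPolynomial.eval (c + t • v) P‖ ≤ M) :
    ‖MvPolynomial.eval c ((D ^ k) P)‖ ≤ k.factorial * M / R ^ k := by
  have h : ∀ k, iteratedDeriv k (fun t : ℂ => MvPolynomial.eval (c + t • v) P) =
      fun t : ℂ => MvPolynomial.eval (c + t • v) ((D ^ k) P) := by
    intro k
    induction k with
    | zero => simp
    | succ k ih =>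
      rw [iteratedDeriv_succ, ih, pow_succ', Module.End.mul_apply]
      ext t
      exact (hD _ t).deriv
  have hd : Differentiable ℂ (fun t : ℂ => MvPolynomial.eval (c + t • v) P) :=
    fun t => (hD P t).differentiableAt
  have := Complex.norm_iteratedDeriv_le_of_forall_mem_sphere_norm_le (c := 0) k hR hd.diffContOnCl
    (C := M) (fun z hz => hM z (by simpa using hz))
  rw [h] at this
  simpa using this

/-- Cauchy's estimates for mixed tangential and vertical derivatives. -/
lemma abs_Dtan_iterate_pd2_le (g : ℝ → ℝ) (r m : ℕ) (P : MvPolynomial (Fin 2) ℝ) (q : ℝ × ℝ)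
    {τ σ M : ℝ} (hτ : 0 < τ) (hσ : 0 < σ)
    (hM : ∀ t s : ℂ, ‖t‖ = τ → ‖s‖ = σ → ‖MvPolynomial.eval
      ![q.1 + t, q.2 + ((deriv g q.1 : ℝ) : ℂ) * t + s] (MvPolynomial.map (algebraMap ℝ ℂ) P)‖ ≤ M) :
    |Dtan g r (pd2^[m] (fun q => MvPolynomial.eval ![q.1, q.2] P)) q| ≤
      r.factorial * m.factorial * M / (τ ^ r * σ ^ m) := by
  have hL : ∀ (c : Fin 2 → ℂ) (P : MvPolynomial (Fin 2) ℂ) (t : ℂ), HasDerivAt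
      (fun t : ℂ => MvPolynomial.eval (c + t • ![1, ((deriv g q.1 : ℝ) : ℂ)]) P)
      (MvPolynomial.eval (c + t • ![1, ((deriv g q.1 : ℝ) : ℂ)]) (tangentPDeriv ((deriv g q.1 : ℝ) : ℂ) P))
      t := by
    intro c P t
    refine (hasDerivAt_eval_line P c _ t).congr_deriv ?_
    simp [tangentPDeriv, -Complex.coe_smul]
  have hS : ∀ (c : Fin 2 → ℂ) (P : MvPolynomial (Fin 2) ℂ) (t : ℂ), HasDerivAt
      (fun t : ℂ => MvPolynomial.eval (c + t • ![0, 1]) P)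
      (MvPolynomial.eval (c + t • ![0, 1]) ((MvPolynomial.pderiv 1).toLinearMap P)) t := by
    intro c P t
    refine (hasDerivAt_eval_line P c _ t).congr_deriv ?_
    simp
  have key := norm_eval_pow_le_of_line (c := ![(q.1 : ℂ), q.2]) (hL _)
    (((MvPolynomial.pderiv 1).toLinearMap ^ m : Module.End ℂ (MvPolynomial (Fin 2) ℂ))
        (MvPolynomial.map (algebraMap ℝ ℂ) P)) r hτ (M := m.factorial * M / σ ^ m)
    (fun t ht => norm_eval_pow_le_of_line (hS _) _ m hσ fun s hs => by
      have := hM t s ht hs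
      simpa [mul_comm] using this)
  rw [iterate_pd2_eval, Dtan_eval]
  rw [← map_pderiv_pow, ← map_tangentPDeriv_pow] at key
  have h : MvPolynomial.eval ![(q.1 : ℂ), q.2] (MvPolynomial.map (algebraMap ℝ ℂ)
      ((tangentPDeriv (deriv g q.1) ^ r) (((MvPolynomial.pderiv 1).toLinearMap ^ m :
        Module.End ℝ (MvPolynomial (Fin 2) ℝ)) P))) =
      ((MvPolynomial.eval ![q.1, q.2] ((tangentPDeriv (deriv g q.1) ^ r)
        (((MvPolynomial.pderiv 1).toLinearMap ^ m :
        Module.End ℝ (MvPolynomial (Fin 2) ℝ)) P)) : ℝ) : ℂ) := by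
    have h1 : ![(q.1 : ℂ), q.2] = fun i => algebraMap ℝ ℂ (![q.1, q.2] i) := by
      ext i
      fin_cases i <;> rfl
    rw [h1, MvPolynomial.eval_map]
    exact (MvPolynomial.eval₂_comp (algebraMap ℝ ℂ) ![q.1, q.2] _).symm
  rw [h, Complex.norm_real, Real.norm_eq_abs] at key
  refine key.trans_eq ?_
  field_simp

/-- Consequences of smallness of the perturbation `v` of `d` for `z = 1 - 2 (d - v) / ℓ`. -/
lemma near_cos_arccos_of_norm_le {ℓ d ρ u : ℝ} (hℓ : 0 < ℓ) (hd : 0 ≤ d)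
    (hρ : ρ ≤ 1 - d / ℓ) (hρ0 : 0 < ρ) {v : ℂ} (hv : ‖v‖ ≤ ρ * ℓ / 2)
    (hdv : d / 2 ≤ ‖(d : ℂ) - v‖)
    (hr : 2 / ℓ * ‖v‖ ≤ 1 / 32 * (Real.sin (Real.arccos (1 - 2 * d / ℓ)) * (u / 2) + (u / 2) ^ 2)) :
    ‖1 - 2 * ((d : ℂ) - v) / ℓ - Real.cos (Real.arccos (1 - 2 * d / ℓ))‖ ≤
      1 / 32 * (|Real.sin (Real.arccos (1 - 2 * d / ℓ))| * (u / 2) + (u / 2) ^ 2) ∧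
    √ρ / 2 * Real.sin (Real.arccos (1 - 2 * d / ℓ)) ≤
      √‖(1 - 2 * ((d : ℂ) - v) / ℓ) ^ 2 - 1‖ := by
  have hℓc : (ℓ : ℂ) ≠ 0 := by exact_mod_cast hℓ.ne'
  have hdl : 0 ≤ d / ℓ := by positivity
  have hcos : Real.cos (Real.arccos (1 - 2 * d / ℓ)) = 1 - 2 * d / ℓ := by
    rw [mul_div_assoc]
    exact Real.cos_arccos (by linarith) (by linarith)
  have hsin := Real.sin_arccos (1 - 2 * d / ℓ)
  have hsin0 : 0 ≤ Real.sin (Real.arccos (1 - 2 * d / ℓ)) := by rw [hsin]; positivity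
  constructor
  · rw [abs_of_nonneg hsin0]
    refine le_trans (le_of_eq ?_) hr
    rw [hcos]
    have : (1 - 2 * ((d : ℂ) - v) / ℓ - ((1 - 2 * d / ℓ : ℝ) : ℂ)) = ((2 / ℓ : ℝ) : ℂ) * v := by
      push_cast
      field_simp
      ring
    rw [this, norm_mul, Complex.norm_real, Real.norm_of_nonneg (by positivity)]
  · rw [hsin, show √ρ / 2 = √(ρ / 4) by rw [Real.sqrt_div hρ0.le]; norm_num,
      ← Real.sqrt_mul (by positivity)]
    refine Real.sqrt_le_sqrt ?_
    have h1 : (1 - 2 * ((d : ℂ) - v) / ℓ) ^ 2 - 1 =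
        -((4 / ℓ ^ 2 : ℝ) : ℂ) * (d - v) * ((ℓ - d : ℝ) + v) := by
      push_cast
      field_simp
      ring
    have h2 : ρ * ℓ / 2 ≤ ‖((ℓ - d : ℝ) : ℂ) + v‖ := by
      have h3 := norm_sub_norm_le ((ℓ - d : ℝ) : ℂ) (-v)
      rw [sub_neg_eq_add, norm_neg, Complex.norm_real] at h3
      have h4 : ρ * ℓ ≤ ℓ - d := by
        have := mul_le_mul_of_nonneg_right hρ hℓ.le
        field_simp at this
        linarith
      have h5 := Real.le_norm_self (ℓ - d)
      linarith
    rw [h1, norm_mul, norm_mul, norm_neg, Complex.norm_real, Real.norm_of_nonneg (by positivity)]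
    calc ρ / 4 * (1 - (1 - 2 * d / ℓ) ^ 2) = ρ * (d / ℓ) * (1 - d / ℓ) := by ring
      _ ≤ ρ * (d / ℓ) * 1 := by gcongr; linarith
      _ = 4 / ℓ ^ 2 * (d / 2) * (ρ * ℓ / 2) := by field_simp; ring
      _ ≤ _ := by gcongr

lemma exists_perturbation_radius {ℓ d ρ η K u w S : ℝ} (hℓ : 0 < ℓ) (hρ0 : 0 < ρ) (hρ1 : ρ ≤ 1)
    (hη0 : 0 < η) (hη2 : η ^ 2 = ρ ^ 2 * ℓ / 1280) (hK : K ≤ η ^ 2 / 4) (hu0 : 0 < u) (hu1 : u ≤ 1)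
    (hw0 : 0 ≤ w) (hwd : w ^ 2 = d) (hdl : d ≤ ℓ) (hS0 : 0 ≤ S) (hS2 : 4 * ρ * d / ℓ ≤ S ^ 2) :
    ∃ σ : ℝ, 0 < σ ∧ η ^ 2 / (4 * (1 + η)) * (w + u) * u ≤ σ ∧
      ∀ v : ℂ, ‖v‖ ≤ K * u ^ 2 + σ → σ - K * u ^ 2 ≤ ‖v‖ →
        ‖v‖ ≤ ρ * ℓ / 2 ∧ d / 2 ≤ ‖(d : ℂ) - v‖ ∧
          2 / ℓ * ‖v‖ ≤ 1 / 32 * (S * (u / 2) + (u / 2) ^ 2) := by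
  have hd0 : 0 ≤ d := hwd ▸ sq_nonneg w
  have hρ2 : ρ ^ 2 ≤ ρ := by nlinarith
  have hη3 : η ^ 2 ≤ ρ * ℓ / 1280 := by rw [hη2]; gcongr
  have hη4 : η ^ 2 ≤ ℓ / 1280 := hη3.trans (by gcongr; nlinarith)
  have hdn : ‖(d : ℂ)‖ = d := by rw [Complex.norm_real, Real.norm_of_nonneg hd0]
  rcases le_total (η * u) w with hcase | hcase
  · have hw0' : 0 < w := lt_of_lt_of_le (by positivity) hcase
    refine ⟨η / 4 * w * u, by positivity, ?_, fun v hv _ => ?_⟩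
    · have h1 : η * (w + u) ≤ (1 + η) * w := by linarith
      calc η ^ 2 / (4 * (1 + η)) * (w + u) * u = η / (4 * (1 + η)) * u * (η * (w + u)) := by ring
        _ ≤ η / (4 * (1 + η)) * u * ((1 + η) * w) := by gcongr
        _ = _ := by field_simp
    · have hb1 : K * u ^ 2 ≤ η ^ 2 / 4 * u ^ 2 := by gcongr
      have hηu := mul_pos hη0 hu0
      have hb2 : (η * u) * (η * u) ≤ w * (η * u) := mul_le_mul_of_nonneg_right hcase hηu.le
      have hb3 : w * (η * u) ≤ w * w := mul_le_mul_of_nonneg_left hcase hw0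
      have hvd : ‖v‖ ≤ d / 2 := by linarith
      refine ⟨?_, ?_, ?_⟩
      · have h1 : η * w ≤ ρ * ℓ / 2 := by
          refine abs_le_of_sq_le_sq' ?_ (by positivity) |>.2
          rw [mul_pow, hwd, hη2]
          have : ρ ^ 2 * ℓ / 1280 * d ≤ ρ ^ 2 * ℓ / 1280 * ℓ := by gcongr
          have h2 : 0 ≤ ρ ^ 2 * ℓ * ℓ := by positivity
          linarith
        have h2 : w * (η * u) ≤ η * w := by
          have := mul_le_mul_of_nonneg_left hu1 (mul_nonneg hη0.le hw0)
          linarith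
        have := mul_nonneg hη0.le hw0
        linarith
      · have := norm_sub_norm_le (d : ℂ) v
        rw [hdn] at this
        linarith
      · have h1 : 32 * (η * w) ≤ ℓ * S := by
          refine abs_le_of_sq_le_sq' ?_ (by positivity) |>.2
          calc (32 * (η * w)) ^ 2 = 1024 * (η ^ 2 * d) := by rw [← hwd]; ring
            _ ≤ 1024 * (ρ * ℓ / 1280 * d) := by gcongr
            _ ≤ ℓ ^ 2 * (4 * ρ * d / ℓ) := by
              have h1 := mul_nonneg (mul_nonneg hρ0.le hℓ.le) hd0
              have h2 : ℓ ^ 2 * (4 * ρ * d / ℓ) = 4 * (ρ * ℓ * d) := by field_simp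
              linarith
            _ ≤ ℓ ^ 2 * S ^ 2 := by gcongr
            _ = (ℓ * S) ^ 2 := by ring
        have h2 : ‖v‖ ≤ ℓ / 1280 / 4 * u ^ 2 + ℓ * S / 128 * u := by
          have h3 : η ^ 2 / 4 * u ^ 2 ≤ ℓ / 1280 / 4 * u ^ 2 := by gcongr
          have h4 : 32 * (η * w) * u ≤ ℓ * S * u := by gcongr
          linarith
        calc 2 / ℓ * ‖v‖ ≤ 2 / ℓ * (ℓ / 1280 / 4 * u ^ 2 + ℓ * S / 128 * u) := by gcongr
          _ = u ^ 2 / 2560 + S * u / 64 := by field_simp; ring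
          _ ≤ _ := by nlinarith [sq_nonneg u]
  · refine ⟨4 * η ^ 2 * u ^ 2, by positivity, ?_, fun v hv hv' => ?_⟩
    · have h1 : w + u ≤ (1 + η) * u := by linarith
      calc η ^ 2 / (4 * (1 + η)) * (w + u) * u ≤ η ^ 2 / (4 * (1 + η)) * ((1 + η) * u) * u := by
            gcongr
        _ = η ^ 2 * u ^ 2 / 4 := by field_simp
        _ ≤ _ := by nlinarith [mul_pos (pow_pos hη0 2) (pow_pos hu0 2)]
    · have hb1 : K * u ^ 2 ≤ η ^ 2 / 4 * u ^ 2 := by gcongr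
      have hb0 := mul_pos (pow_pos hη0 2) (pow_pos hu0 2)
      have hvn : ‖v‖ ≤ 5 * (η ^ 2 * u ^ 2) := by linarith
      have hd1 : d ≤ η ^ 2 * u ^ 2 := by rw [← hwd, ← mul_pow]; exact pow_le_pow_left₀ hw0 hcase 2
      refine ⟨?_, ?_, ?_⟩
      · have h1 : η ^ 2 * u ^ 2 ≤ ρ * ℓ / 1280 * 1 ^ 2 := by gcongr
        have := mul_pos hρ0 hℓ
        linarith
      · have := norm_sub_norm_le v (d : ℂ)
        rw [hdn, norm_sub_rev] at this
        linarith
      · have h1 : η ^ 2 * u ^ 2 ≤ ℓ / 1280 * u ^ 2 := by gcongr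
        calc 2 / ℓ * ‖v‖ ≤ 2 / ℓ * (5 * (ℓ / 1280 * u ^ 2)) := by
              gcongr
              linarith
          _ = u ^ 2 / 128 := by field_simp; norm_num
          _ ≤ _ := by nlinarith [mul_nonneg hS0 hu0.le]

/-- Choice of the radii in Cauchy's estimates. -/
lemma exists_cauchy_radii {ℓ B A δ : ℝ} (hℓ : 0 < ℓ) (hB0 : 0 ≤ B) (hB : B < ℓ) (hA : 0 < A)
    (hδ : 0 < δ) : ∃ τ₀ c₁ c₂ : ℝ, 0 < τ₀ ∧ 0 < c₁ ∧ 0 < c₂ ∧ τ₀ ≤ δ / 128 ∧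
      ∀ n : ℕ, 0 < n → ∀ d ∈ Icc 0 B, ∃ σ : ℝ, 0 < σ ∧ c₂ * (√d + 1 / n) / n ≤ σ ∧
        ∀ t s : ℂ, ‖t‖ = τ₀ / n → ‖s‖ = σ → ∃ z : ℂ, d - A * t ^ 2 - s = ℓ * (1 - z) / 2 ∧
          ‖z - Real.cos (Real.arccos (1 - 2 * d / ℓ))‖ ≤
            1 / 32 * (|Real.sin (Real.arccos (1 - 2 * d / ℓ))| / ((2 * n : ℕ) : ℝ) +
              1 / ((2 * n : ℕ) : ℝ) ^ 2) ∧
          c₁ * Real.sin (Real.arccos (1 - 2 * d / ℓ)) ≤ √‖z ^ 2 - 1‖ := by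
  have hℓc : (ℓ : ℂ) ≠ 0 := by exact_mod_cast hℓ.ne'
  set ρ := 1 - B / ℓ with hρ
  have hρ0 : 0 < ρ := by rw [hρ, sub_pos, div_lt_one hℓ]; exact hB
  have hρ1 : ρ ≤ 1 := by have : 0 ≤ B / ℓ := by positivity
                         linarith
  set η := ρ * √(ℓ / 1280) with hη
  have hη0 : 0 < η := by positivity
  have hη2 : η ^ 2 = ρ ^ 2 * ℓ / 1280 := by
    rw [hη, mul_pow, Real.sq_sqrt (by positivity)]
    ring
  set τ₀ := min (δ / 128) (η / (2 * √A)) with hτ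
  have hτ0 : 0 < τ₀ := lt_min (by positivity) (by positivity)
  have hAτ : A * τ₀ ^ 2 ≤ η ^ 2 / 4 := by
    calc A * τ₀ ^ 2 ≤ A * (η / (2 * √A)) ^ 2 := by gcongr; exact min_le_right _ _
      _ = η ^ 2 / 4 := by
        rw [div_pow, mul_pow 2 √A, Real.sq_sqrt hA.le]
        field_simp
        norm_num
  refine ⟨τ₀, √ρ / 2, η ^ 2 / (4 * (1 + η)), hτ0, by positivity, by positivity, min_le_left _ _,
    fun n hn d hd => ?_⟩
  have hn1 : (1 : ℝ) ≤ n := by exact_mod_cast hn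
  have hd0 : 0 ≤ d := hd.1
  set u : ℝ := 1 / n with hu
  have hu0 : 0 < u := by positivity
  have hu1 : u ≤ 1 := by rw [hu, div_le_one (by positivity)]; exact hn1
  set w := √d with hw
  have hw0 : 0 ≤ w := Real.sqrt_nonneg _
  have hwd : w ^ 2 = d := Real.sq_sqrt hd0
  have hρd : ρ ≤ 1 - d / ℓ := by
    rw [hρ]
    gcongr
    exact hd.2
  have hdl : d ≤ ℓ := hd.2.trans hB.le
  set S := Real.sin (Real.arccos (1 - 2 * d / ℓ)) with hS
  have hS' := Real.sin_arccos (1 - 2 * d / ℓ)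
  have hS0 : 0 ≤ S := by rw [hS, hS']; positivity
  have hS2 : 4 * ρ * d / ℓ ≤ S ^ 2 := by
    have h1 : 1 - (1 - 2 * d / ℓ) ^ 2 = 4 * (d / ℓ) * (1 - d / ℓ) := by ring
    have h2 : 0 ≤ d / ℓ := by positivity
    rw [hS, hS', Real.sq_sqrt, h1, show 4 * ρ * d / ℓ = 4 * (d / ℓ) * ρ by ring]
    · gcongr
    · rw [h1]
      have := hρ0.trans_le hρd
      positivity
  obtain ⟨σ, hσ0, hσ1, hσ⟩ := exists_perturbation_radius hℓ hρ0 hρ1 hη0 hη2 hAτ hu0 hu1 hw0 hwd hdl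
    hS0 hS2
  refine ⟨σ, hσ0, le_trans (le_of_eq (by rw [hu]; ring)) hσ1, fun t s ht hs => ?_⟩
  have hAt : ‖(A : ℂ) * t ^ 2‖ = A * τ₀ ^ 2 * u ^ 2 := by
    rw [norm_mul, norm_pow, ht, Complex.norm_real, Real.norm_of_nonneg hA.le, hu]
    ring
  obtain ⟨h1, h2, h3⟩ := hσ (A * t ^ 2 + s) ((norm_add_le _ _).trans_eq (by rw [hAt, hs]))
    (by
      have := norm_sub_norm_le s (-((A : ℂ) * t ^ 2))
      rw [sub_neg_eq_add, norm_neg, hAt, hs, add_comm s] at this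
      exact this)
  obtain ⟨h4, h5⟩ := near_cos_arccos_of_norm_le hℓ hd0 hρd hρ0 h1 h2 h3
  refine ⟨1 - 2 * ((d : ℂ) - (A * t ^ 2 + s)) / ℓ, ?_, h4.trans_eq ?_, h5⟩
  · field_simp
    ring
  · rw [hu]
    push_cast
    ring

/-- The point with abscissa `x + T` lying `ℓ (1 - c) / 2` below a parabola tangent to the graph
of `g` at `x`. -/
def parabolaPoint (g : ℝ → ℝ) (A ℓ x T c : ℝ) : ℝ × ℝ :=
  (x + T, g x + deriv g x * T - A * T ^ 2 - ℓ * (1 - c) / 2)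

lemma eval_aeval_polynomial {R σ : Type*} [CommRing R] (v : σ → Polynomial R) (P : MvPolynomial σ R)
    (t : R) : (MvPolynomial.aeval v P).eval t = MvPolynomial.eval (fun i => (v i).eval t) P := by
  induction P using MvPolynomial.induction_on with
  | C a => simp
  | add p q hp hq => simp [hp, hq]
  | mul_X p i hp => simp [hp]

lemma exists_polynomial_eval_curve {n k : ℕ} {P : MvPolynomial (Fin 2) ℂ} (hP : P.totalDegree ≤ n)
    {u v : Polynomial ℂ} (hu : u.natDegree ≤ k) (hv : v.natDegree ≤ k) :
    ∃ Q : Polynomial ℂ, Q.natDegree ≤ n * k ∧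
      ∀ t, MvPolynomial.eval ![u.eval t, v.eval t] P = Q.eval t := by
  refine ⟨MvPolynomial.aeval ![u, v] P, MvPolynomial.aeval_natDegree_le P hP _ fun i => ?_,
    fun t => ?_⟩
  · fin_cases i
    · exact hu
    · exact hv
  · rw [eval_aeval_polynomial]
    congr 2
    ext i
    fin_cases i <;> rfl

/-- The complexification of a real polynomial along a family of parabolas. -/
def parabolaExtension (P : MvPolynomial (Fin 2) ℝ) (g : ℝ → ℝ) (A ℓ x : ℝ) (t z : ℂ) : ℂ :=
  MvPolynomial.eval ![x + t, g x + (deriv g x : ℝ) * t - A * t ^ 2 - ℓ * (1 - z) / 2]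
    (MvPolynomial.map (algebraMap ℝ ℂ) P)

lemma totalDegree_map_algebraMap (P : MvPolynomial (Fin 2) ℝ) :
    (MvPolynomial.map (algebraMap ℝ ℂ) P).totalDegree = P.totalDegree := by
  simp [MvPolynomial.totalDegree, MvPolynomial.support_map_of_injective P (algebraMap ℝ ℂ).injective]

lemma exists_polynomial_parabolaExtension_left {P : MvPolynomial (Fin 2) ℝ} {n : ℕ}
    (hP : P.totalDegree ≤ n) (g : ℝ → ℝ) (A ℓ x : ℝ) (z : ℂ) :
    ∃ Q : Polynomial ℂ, Q.natDegree ≤ 2 * n ∧ ∀ t, parabolaExtension P g A ℓ x t z = Q.eval t := by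
  obtain ⟨Q, hQ, hQe⟩ := exists_polynomial_eval_curve
    ((totalDegree_map_algebraMap P).trans_le hP)
    (u := Polynomial.C (x : ℂ) + Polynomial.X)
    (v := Polynomial.C (g x : ℂ) + Polynomial.C ((deriv g x : ℝ) : ℂ) * Polynomial.X -
      Polynomial.C (A : ℂ) * Polynomial.X ^ 2 - Polynomial.C (ℓ * (1 - z) / 2)) (k := 2)
    (by compute_degree; norm_num) (by compute_degree)
  refine ⟨Q, by omega, fun t => ?_⟩
  rw [← hQe]
  simp [parabolaExtension]

lemma exists_polynomial_parabolaExtension_right {P : MvPolynomial (Fin 2) ℝ} {n : ℕ}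
    (hP : P.totalDegree ≤ n) (g : ℝ → ℝ) (A ℓ x : ℝ) (t : ℂ) :
    ∃ Q : Polynomial ℂ, Q.natDegree ≤ n ∧ ∀ z, parabolaExtension P g A ℓ x t z = Q.eval z := by
  obtain ⟨Q, hQ, hQe⟩ := exists_polynomial_eval_curve
    ((totalDegree_map_algebraMap P).trans_le hP)
    (u := Polynomial.C (x + t : ℂ))
    (v := Polynomial.C (g x + (deriv g x : ℝ) * t - A * t ^ 2 - ℓ / 2 : ℂ) +
      Polynomial.C (ℓ / 2 : ℂ) * Polynomial.X) (k := 1)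
    (by compute_degree; norm_num) (by compute_degree)
  refine ⟨Q, by omega, fun z => ?_⟩
  rw [← hQe, parabolaExtension]
  simp only [Polynomial.eval_add, Polynomial.eval_mul, Polynomial.eval_C, Polynomial.eval_X]
  congr 3
  ring_nf

lemma norm_parabolaExtension_ofReal (P : MvPolynomial (Fin 2) ℝ) (g : ℝ → ℝ) (A ℓ x T c : ℝ) :
    ‖parabolaExtension P g A ℓ x T c‖ = |MvPolynomial.eval
      ![(parabolaPoint g A ℓ x T c).1, (parabolaPoint g A ℓ x T c).2] P| := by
  rw [← Real.norm_eq_abs, ← Complex.norm_real]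
  congr 1
  refine Eq.trans ?_ (MvPolynomial.eval₂_comp (algebraMap ℝ ℂ) _ P).symm
  rw [parabolaExtension, ← MvPolynomial.eval_map]
  congr 2
  ext k
  fin_cases k <;> simp [parabolaPoint]

/-- Pointwise form of the Bernstein inequality: the derivative at a point is controlled by an
average of the polynomial over a family of points on parabolas. -/
lemma exists_pointwise_bernstein {ℓ B A δ : ℝ} (hℓ : 0 < ℓ) (hB0 : 0 ≤ B) (hB : B < ℓ) (hA : 0 < A)
    (hδ : 0 < δ) {p : ℝ} (hp : 0 < p) {e : ℕ} (he : e ≤ 1) (r i j : ℕ) :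
    ∃ C : ℝ, 0 < C ∧ ∀ (g : ℝ → ℝ) (n : ℕ), 0 < n → ∀ f : ℝ × ℝ → ℝ, IsPoly2 n f →
      ∀ q : ℝ × ℝ, g q.1 - q.2 ∈ Icc 0 B →
        ENNReal.ofReal (|phi2 g n q ^ i * Dtan g r (pd2^[i + j] f) q| ^ p *
          Real.sin (Real.arccos (1 - 2 * (g q.1 - q.2) / ℓ)) ^ e) ≤
        ENNReal.ofReal (C * ((n : ℝ) ^ (r + i + 2 * j)) ^ p) * ∫⁻ β, ∫⁻ τ,
          ENNReal.ofReal (|f (parabolaPoint g A ℓ q.1 (δ * Real.cos (Real.pi / 2 + τ))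
              (Real.cos (Real.arccos (1 - 2 * (g q.1 - q.2) / ℓ) + β)))| ^ p *
            |Real.sin (Real.arccos (1 - 2 * (g q.1 - q.2) / ℓ) + β)| ^ e)
          ∂angleMeasure (2 * (2 * n)) ∂angleMeasure (2 * n) := by
  obtain ⟨τ₀, c₁, c₂, hτ0, hc1, hc2, hτδ, H⟩ := exists_cauchy_radii hℓ hB0 hB hA hδ
  set K := (2 ^ p * 12 * Real.exp (2 * (p + 1))) ^ 2 with hK
  have hK0 : 0 < K := by positivity
  set W : ℝ := r.factorial * (i + j).factorial / (τ₀ ^ r * c₂ ^ (i + j)) with hW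
  have hW0 : 0 < W := by positivity
  refine ⟨W ^ p * (K / c₁ ^ e), by positivity, fun g n hn f hf q hd => ?_⟩
  obtain ⟨P, hP, hPf⟩ := hf
  obtain rfl : f = fun q => MvPolynomial.eval ![q.1, q.2] P := funext hPf
  have hn0 : (0 : ℝ) < n := by exact_mod_cast hn
  obtain ⟨σ, hσ0, hσ, Hσ⟩ := H n hn _ hd
  set d := g q.1 - q.2 with hdd
  set θ := Real.arccos (1 - 2 * d / ℓ) with hθ
  set S := Real.sin θ with hS
  have hS0 : 0 ≤ S := by
    rw [hS, hθ, Real.sin_arccos]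
    positivity
  set I := ∫⁻ β, ∫⁻ τ, ENNReal.ofReal (|MvPolynomial.eval
      ![(parabolaPoint g A ℓ q.1 (δ * Real.cos (Real.pi / 2 + τ)) (Real.cos (θ + β))).1,
        (parabolaPoint g A ℓ q.1 (δ * Real.cos (Real.pi / 2 + τ)) (Real.cos (θ + β))).2] P| ^ p *
      |Real.sin (θ + β)| ^ e) ∂angleMeasure (2 * (2 * n)) ∂angleMeasure (2 * n) with hI
  have hnN : (0 : ℝ) < (n : ℝ) ^ (r + i + 2 * j) := by positivity
  by_cases hItop : I = ⊤
  · rw [hItop, ENNReal.mul_top]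
    · exact le_top
    · simp only [ne_eq, ENNReal.ofReal_eq_zero, not_le]
      positivity
  by_cases hSe : S ^ e = 0
  · rw [hSe]
    simp
  have hSe0 : 0 < S ^ e := lt_of_le_of_ne (by positivity) (Ne.symm hSe)
  set M := (K / c₁ ^ e * I.toReal / S ^ e) ^ (1 / p) with hM
  have hMp : M ^ p = K / c₁ ^ e * I.toReal / S ^ e := by
    rw [hM, ← Real.rpow_mul (by positivity), one_div_mul_cancel hp.ne', Real.rpow_one]
  have hM0 : 0 ≤ M := by positivity
  have hcauchy := abs_Dtan_iterate_pd2_le g r (i + j) P q (M := M) (div_pos hτ0 hn0) hσ0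
    fun t s ht hs => by
      obtain ⟨z, hz1, hz2, hz3⟩ := Hσ t s ht hs
      have h1 := ofReal_norm_near_cos_le_lintegral_lintegral hp he hn
        (exists_polynomial_parabolaExtension_left hP g A ℓ q.1)
        (exists_polynomial_parabolaExtension_right hP g A ℓ q.1) hδ (t := t) (z := z) (θ := θ) (by
          rw [ht, ← div_div]
          gcongr) hz2
      simp only [norm_parabolaExtension_ofReal] at h1
      rw [← hI, ← hK, ← ENNReal.ofReal_toReal hItop, ← ENNReal.ofReal_mul hK0.le,
        ENNReal.ofReal_le_ofReal_iff (by positivity)] at h1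
      have h2 : parabolaExtension P g A ℓ q.1 t z = MvPolynomial.eval
          ![q.1 + t, q.2 + ((deriv g q.1 : ℝ) : ℂ) * t + s]
            (MvPolynomial.map (algebraMap ℝ ℂ) P) := by
        rw [parabolaExtension]
        congr 3
        rw [← hz1, hdd]
        push_cast
        ring_nf
      rw [← h2]
      generalize parabolaExtension P g A ℓ q.1 t z = v at *
      rw [← Real.rpow_le_rpow_iff (norm_nonneg _) hM0 hp, hMp, le_div_iff₀ hSe0]
      have h3 : (c₁ * S) ^ e ≤ √‖z ^ 2 - 1‖ ^ e := by gcongr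
      rw [mul_pow] at h3
      calc ‖v‖ ^ p * S ^ e = ‖v‖ ^ p * (c₁ ^ e * S ^ e) / c₁ ^ e := by field_simp
        _ ≤ ‖v‖ ^ p * √‖z ^ 2 - 1‖ ^ e / c₁ ^ e := by gcongr
        _ ≤ K * I.toReal / c₁ ^ e := by gcongr
        _ = _ := by ring
  have hφ : phi2 g n q = √d + 1 / n := rfl
  set φ := phi2 g n q with hφdef
  have hφn : 1 ≤ n * φ := by
    rw [hφ, mul_add, mul_one_div_cancel hn0.ne']
    have : 0 ≤ n * √d := by positivity
    linarith
  have hφ0 : 0 < φ := by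
    by_contra! h
    nlinarith
  rw [← hφ] at hσ
  have hbound : |φ ^ i * Dtan g r (pd2^[i + j] fun q => MvPolynomial.eval ![q.1, q.2] P) q| ≤
      W * (n : ℝ) ^ (r + i + 2 * j) * M := by
    rw [abs_mul, abs_of_pos (pow_pos hφ0 i)]
    calc _ ≤ φ ^ i * (r.factorial * (i + j).factorial * M / ((τ₀ / n) ^ r * σ ^ (i + j))) := by
          gcongr
      _ ≤ φ ^ i * (r.factorial * (i + j).factorial * M /
            ((τ₀ / n) ^ r * (c₂ * φ / n) ^ (i + j))) := by gcongr
      _ ≤ (n * φ) ^ j * (φ ^ i * (r.factorial * (i + j).factorial * M /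
            ((τ₀ / n) ^ r * (c₂ * φ / n) ^ (i + j)))) :=
          le_mul_of_one_le_left (by positivity) (one_le_pow₀ hφn)
      _ = _ := by
          have h1 : (n : ℝ) ^ (r + i + 2 * j) = n ^ r * n ^ (i + j) * n ^ j := by ring
          have h2 : φ ^ (i + j) = φ ^ i * φ ^ j := pow_add _ _ _
          rw [hW, h1, div_pow, div_pow, mul_pow, mul_pow, h2]
          field_simp
  rw [← ENNReal.ofReal_toReal hItop, ← ENNReal.ofReal_mul (by positivity)]
  refine ENNReal.ofReal_le_ofReal ?_
  calc _ ≤ (W * (n : ℝ) ^ (r + i + 2 * j) * M) ^ p * S ^ e := by gcongr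
    _ = _ := by
      rw [Real.mul_rpow (by positivity) hM0, Real.mul_rpow hW0.le hnN.le, hMp]
      field_simp

lemma exists_abs_taylor_le {g : ℝ → ℝ} (hg : ContDiff ℝ 2 g) (X : ℝ) :
    ∃ A : ℝ, 0 < A ∧ ∀ x T, x ∈ Icc (-X) X → x + T ∈ Icc (-X) X →
      |g (x + T) - g x - deriv g x * T| ≤ A * T ^ 2 := by
  have hg' : ContDiff ℝ 1 (deriv g) :=
    ((contDiff_succ_iff_deriv (n := 1)).1 (by simpa [one_add_one_eq_two] using hg)).2.2
  obtain ⟨A, hA⟩ := (isCompact_Icc (a := -X) (b := X)).exists_bound_of_continuousOn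
    (hg'.continuous_deriv le_rfl).continuousOn
  refine ⟨max A 1, by positivity, fun x T hx hxT => ?_⟩
  have hseg : uIcc x (x + T) ⊆ Icc (-X) X := uIcc_subset_Icc hx hxT
  have h1 : ∀ u ∈ uIcc x (x + T), ‖deriv g u - deriv g x‖ ≤ max A 1 * |T| := by
    intro u hu
    have h2 := (convex_Icc (-X) X).norm_image_sub_le_of_norm_deriv_le
      (fun v _ => (hg'.differentiable one_ne_zero) v)
      (fun v hv => (hA v hv).trans (le_max_left A 1)) hx (hseg hu)
    refine h2.trans ?_
    gcongr
    have := abs_sub_left_of_mem_uIcc hu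
    simpa [abs_sub_comm] using this
  have h3 : ∀ v, HasDerivAt (fun v => g v - deriv g x * v) (deriv g v - deriv g x) v := by
    intro v
    have h4 := ((hg.differentiable two_ne_zero) v).hasDerivAt
    exact (h4.fun_sub ((hasDerivAt_id' v).const_mul (deriv g x))).congr_deriv (by simp)
  have h5 := (convex_uIcc x (x + T)).norm_image_sub_le_of_norm_hasDerivWithin_le
    (fun v _ => (h3 v).hasDerivWithinAt) h1 left_mem_uIcc right_mem_uIcc
  rw [Real.norm_eq_abs, Real.norm_eq_abs, add_sub_cancel_left, mul_assoc, abs_mul_abs_self,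
    ← pow_two] at h5
  convert h5 using 2
  ring

/-- Tangent parabolas of large curvature stay inside the larger domain. -/
lemma exists_parabolaPoint_mem_Gset {a L : ℝ} (ha : 0 < a) (hL : 0 < L) {g : ℝ → ℝ}
    (hg : ContDiff ℝ 2 g) {lam : ℝ} (hlam : 1 < lam) :
    ∃ A δ ℓ : ℝ, 0 < A ∧ 0 < δ ∧ L * a < ℓ ∧ ∀ x ∈ Ioo (-a) a, ∀ T, |T| ≤ δ →
      ∀ c ∈ Icc (-1) 1, parabolaPoint g A ℓ x T c ∈ Gset a L g lam := by
  obtain ⟨A, hA, hAT⟩ := exists_abs_taylor_le hg (lam * a)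
  set κ := (lam - 1) * (L * a) with hκ
  have hκ0 : 0 < κ := mul_pos (by linarith) (by positivity)
  refine ⟨A, min ((lam - 1) * a / 2) (√(κ / (8 * A))), L * a + κ / 2, hA,
    lt_min (by have := mul_pos (sub_pos.2 hlam) ha; positivity) (by positivity), by linarith,
    fun x hx T hT c hc => ?_⟩
  have hT1 := abs_le.1 (hT.trans (min_le_left _ _))
  have hT2 : A * T ^ 2 ≤ κ / 8 := by
    have h1 : |T| ^ 2 ≤ √(κ / (8 * A)) ^ 2 := by
      gcongr
      exact hT.trans (min_le_right _ _)
    rw [sq_abs, Real.sq_sqrt (by positivity)] at h1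
    calc A * T ^ 2 ≤ A * (κ / (8 * A)) := by gcongr
      _ = κ / 8 := by field_simp
  have hla := mul_pos (sub_pos.2 hlam) ha
  have hxT : x + T ∈ Ioo (-(lam * a)) (lam * a) := by
    constructor <;> nlinarith [hx.1, hx.2, hT1.1, hT1.2]
  have hx' : x ∈ Icc (-(lam * a)) (lam * a) := by
    constructor <;> nlinarith [hx.1, hx.2]
  have ht := abs_le.1 (hAT x T hx' (Ioo_subset_Icc_self hxT))
  have hℓ : 0 < L * a + κ / 2 := by positivity
  have hc1 : 0 ≤ (L * a + κ / 2) * (1 - c) := mul_nonneg hℓ.le (by linarith [hc.2])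
  have hc2 : (L * a + κ / 2) * (1 - c) ≤ (L * a + κ / 2) * 2 :=
    mul_le_mul_of_nonneg_left (by linarith [hc.1]) hℓ.le
  have hll : lam * L * a = L * a + κ := by rw [hκ]; ring
  refine ⟨hxT, ?_, ?_⟩ <;> simp only [parabolaPoint] <;> linarith [ht.1, ht.2]

lemma measurableSet_Gset (a L : ℝ) {g : ℝ → ℝ} (hg : Continuous g) (lam : ℝ) :
    MeasurableSet (Gset a L g lam) := by
  have h1 : MeasurableSet {q : ℝ × ℝ | q.1 ∈ Ioo (-(lam * a)) (lam * a)} :=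
    measurable_fst measurableSet_Ioo
  have h2 : MeasurableSet {q : ℝ × ℝ | g q.1 - lam * L * a < q.2} :=
    (isOpen_lt (by fun_prop) (by fun_prop)).measurableSet
  have h3 : MeasurableSet {q : ℝ × ℝ | q.2 ≤ g q.1} :=
    (isClosed_le (by fun_prop) (by fun_prop)).measurableSet
  exact h1.inter (h2.inter h3)

lemma lintegral_Gset (a L : ℝ) {g : ℝ → ℝ} (hg : Continuous g) (lam : ℝ) {h : ℝ × ℝ → ℝ≥0∞}
    (hh : Measurable h) : ∫⁻ q in Gset a L g lam, h q =
      ∫⁻ x in Ioo (-(lam * a)) (lam * a), ∫⁻ y in Ioc (g x - lam * L * a) (g x), h (x, y) := by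
  have hG := measurableSet_Gset a L hg lam
  rw [← lintegral_indicator hG, Measure.volume_eq_prod,
    lintegral_prod _ (hh.indicator hG).aemeasurable, ← lintegral_indicator measurableSet_Ioo]
  congr 1
  ext x
  by_cases hx : x ∈ Ioo (-(lam * a)) (lam * a)
  · rw [indicator_of_mem hx, ← lintegral_indicator measurableSet_Ioc]
    congr 1
    ext y
    simp only [indicator, Gset, mem_ofPred_eq, hx, true_and, mem_Ioc]
  · have h0 : ∀ y, (x, y) ∉ Gset a L g lam := fun y hy => hx hy.1
    simp [indicator_of_notMem hx, indicator_of_notMem (h0 _)]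

lemma injOn_cos_Icc_int_mul_pi (m : ℤ) :
    InjOn Real.cos (Icc (m * Real.pi) ((m + 1) * Real.pi)) := by
  intro x hx y hy h
  have h1 : Real.cos (x - m * Real.pi) = Real.cos (y - m * Real.pi) := by
    rw [Real.cos_sub_int_mul_pi, Real.cos_sub_int_mul_pi, h]
  have := Real.injOn_cos ⟨by linarith [hx.1], by linarith [hx.2]⟩
    ⟨by linarith [hy.1], by linarith [hy.2]⟩ h1
  linarith

lemma lintegral_cos_mul_sin_Icc_int_le (H : ℝ → ℝ≥0∞) (m : ℤ) :
    ∫⁻ θ in Icc (m * Real.pi) ((m + 1) * Real.pi),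
      ENNReal.ofReal |Real.sin θ| * H (Real.cos θ) ≤ ∫⁻ c in Icc (-1) 1, H c := by
  have h := lintegral_image_eq_lintegral_abs_deriv_mul measurableSet_Icc
    (fun θ _ => (Real.hasDerivAt_cos θ).hasDerivWithinAt) (injOn_cos_Icc_int_mul_pi m) H
  simp only [abs_neg] at h
  rw [← h]
  refine lintegral_mono_set ?_
  rintro _ ⟨θ, -, rfl⟩
  exact Real.cos_mem_Icc θ

lemma lintegral_cos_add_mul_sin_le (H : ℝ → ℝ≥0∞) (β : ℝ) :
    ∫⁻ θ in Icc 0 Real.pi, ENNReal.ofReal |Real.sin (θ + β)| * H (Real.cos (θ + β)) ≤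
      2 * ∫⁻ c in Icc (-1) 1, H c := by
  set m := ⌊β / Real.pi⌋ with hm
  have hpi := Real.pi_pos
  have h1 : m * Real.pi ≤ β := (le_div_iff₀ hpi).1 (Int.floor_le _)
  have h2 : β ≤ (m + 1) * Real.pi := ((div_lt_iff₀ hpi).1 (Int.lt_floor_add_one _)).le
  have h3 : ∫⁻ θ in Icc 0 Real.pi, ENNReal.ofReal |Real.sin (θ + β)| * H (Real.cos (θ + β)) =
      ∫⁻ θ in Icc β (Real.pi + β), ENNReal.ofReal |Real.sin θ| * H (Real.cos θ) := by
    rw [← lintegral_indicator measurableSet_Icc, ← lintegral_indicator measurableSet_Icc,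
      ← lintegral_add_right_eq_self ((Icc β (Real.pi + β)).indicator _) β]
    congr 1
    ext θ
    simp [indicator]
  rw [h3, two_mul]
  refine (lintegral_mono_set (t := Icc (m * Real.pi) ((m + 1) * Real.pi) ∪
    Icc (((m + 1 : ℤ) : ℝ) * Real.pi) ((((m + 1 : ℤ) : ℝ) + 1) * Real.pi)) ?_).trans
    ((lintegral_union_le _ _ _).trans (add_le_add (lintegral_cos_mul_sin_Icc_int_le H m)
      (lintegral_cos_mul_sin_Icc_int_le H (m + 1))))
  intro θ hθ
  push_cast
  rcases le_total θ ((m + 1) * Real.pi) with h | h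
  · exact Or.inl ⟨h1.trans hθ.1, h⟩
  · exact Or.inr ⟨h, by linarith [hθ.2]⟩

lemma lintegral_Ioc_le_lintegral_cos {ℓ B : ℝ} (hℓ : 0 < ℓ) (hB : B ≤ ℓ) (b : ℝ) (Φ : ℝ → ℝ≥0∞) :
    ∫⁻ y in Ioc (b - B) b, Φ y ≤ ENNReal.ofReal (ℓ / 2) * ∫⁻ θ in Icc 0 Real.pi,
      ENNReal.ofReal (Real.sin θ) *
        (Ioc (b - B) b).indicator Φ (b - ℓ * (1 - Real.cos θ) / 2) := by
  have hder : ∀ θ, HasDerivAt (fun θ => b - ℓ * (1 - Real.cos θ) / 2) (-(ℓ / 2 * Real.sin θ)) θ := by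
    intro θ
    have := ((((Real.hasDerivAt_cos θ).const_sub 1).const_mul ℓ).div_const 2).const_sub b
    refine this.congr_deriv ?_
    ring
  have hinj : InjOn (fun θ => b - ℓ * (1 - Real.cos θ) / 2) (Icc 0 Real.pi) := by
    intro x hx y hy h
    refine Real.injOn_cos hx hy ?_
    have h1 : ℓ * Real.cos x = ℓ * Real.cos y := by
      simp only at h
      linarith
    exact mul_left_cancel₀ hℓ.ne' h1
  have h := lintegral_image_eq_lintegral_abs_deriv_mul measurableSet_Icc
    (fun θ _ => (hder θ).hasDerivWithinAt) hinj ((Ioc (b - B) b).indicator Φ)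
  have hsub : Ioc (b - B) b ⊆ (fun θ => b - ℓ * (1 - Real.cos θ) / 2) '' Icc 0 Real.pi := by
    intro y hy
    have h1 : 0 ≤ (b - y) / ℓ := div_nonneg (by linarith [hy.2]) hℓ.le
    have h2 : (b - y) / ℓ ≤ 1 := by
      rw [div_le_one hℓ]
      linarith [hy.1]
    refine ⟨Real.arccos (1 - 2 * ((b - y) / ℓ)), ⟨Real.arccos_nonneg _, Real.arccos_le_pi _⟩, ?_⟩
    simp only
    rw [Real.cos_arccos (by linarith) (by linarith)]
    field_simp
    ring
  calc ∫⁻ y in Ioc (b - B) b, Φ y = ∫⁻ y in Ioc (b - B) b, (Ioc (b - B) b).indicator Φ y :=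
        setLIntegral_congr_fun measurableSet_Ioc fun y hy => (indicator_of_mem hy _).symm
    _ ≤ _ := lintegral_mono_set hsub
    _ = _ := h
    _ = _ := by
      rw [← lintegral_const_mul' _ _ ENNReal.ofReal_ne_top]
      refine setLIntegral_congr_fun measurableSet_Icc fun θ hθ => ?_
      rw [abs_neg, abs_of_nonneg (mul_nonneg (by positivity) (Real.sin_nonneg_of_mem_Icc hθ)),
        ENNReal.ofReal_mul (by positivity), mul_assoc]

lemma lintegral_parabolaPoint_le {a A ℓ T : ℝ} (hℓ : 0 < ℓ) {g : ℝ → ℝ} {S : Set (ℝ × ℝ)}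
    (hS : MeasurableSet S)
    (hmem : ∀ x ∈ Ioo (-a) a, ∀ c ∈ Icc (-1) 1, parabolaPoint g A ℓ x T c ∈ S)
    {u : ℝ × ℝ → ℝ≥0∞} (hu : Measurable u) (β : ℝ) :
    ∫⁻ x in Ioo (-a) a, ∫⁻ θ in Icc 0 Real.pi,
      ENNReal.ofReal |Real.sin (θ + β)| * u (parabolaPoint g A ℓ x T (Real.cos (θ + β))) ≤
      2 * ENNReal.ofReal (2 / ℓ) * ∫⁻ q in S, u q := by
  have h1 : ∀ x ∈ Ioo (-a) a, ∫⁻ θ in Icc 0 Real.pi,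
      ENNReal.ofReal |Real.sin (θ + β)| * u (parabolaPoint g A ℓ x T (Real.cos (θ + β))) ≤
      2 * ENNReal.ofReal (2 / ℓ) * ∫⁻ y, S.indicator u (x + T, y) := by
    intro x hx
    refine (lintegral_cos_add_mul_sin_le (fun c => u (parabolaPoint g A ℓ x T c)) β).trans ?_
    rw [mul_assoc]
    gcongr
    set b := g x + deriv g x * T - A * T ^ 2 with hb
    have hder : ∀ c, HasDerivAt (fun c => b - ℓ * (1 - c) / 2) (ℓ / 2) c := by
      intro c
      have := ((((hasDerivAt_id' c).const_sub 1).const_mul ℓ).div_const 2).const_sub b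
      refine this.congr_deriv ?_
      ring
    have hinj : InjOn (fun c => b - ℓ * (1 - c) / 2) (Icc (-1) 1) := by
      intro c _ c' _ h
      have h1 : ℓ * c = ℓ * c' := by
        simp only at h
        linarith
      exact mul_left_cancel₀ hℓ.ne' h1
    have h := lintegral_image_eq_lintegral_abs_deriv_mul measurableSet_Icc
      (fun c _ => (hder c).hasDerivWithinAt) hinj (fun y => S.indicator u (x + T, y))
    calc ∫⁻ c in Icc (-1) 1, u (parabolaPoint g A ℓ x T c)
        = ∫⁻ c in Icc (-1) 1, ENNReal.ofReal (2 / ℓ) * (ENNReal.ofReal |ℓ / 2| *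
            S.indicator u (x + T, b - ℓ * (1 - c) / 2)) := by
          refine setLIntegral_congr_fun measurableSet_Icc fun c hc => ?_
          rw [← mul_assoc, ← ENNReal.ofReal_mul (by positivity), abs_of_pos (by positivity),
            div_mul_div_cancel₀ hℓ.ne', div_self two_ne_zero, ENNReal.ofReal_one, one_mul]
          exact (indicator_of_mem (hmem x hx c hc) u).symm
      _ ≤ _ := by
          rw [lintegral_const_mul' _ _ ENNReal.ofReal_ne_top, ← h]
          exact mul_le_mul_right (setLIntegral_le_lintegral _ _) _
  refine (setLIntegral_mono' measurableSet_Ioo h1).trans ?_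
  rw [lintegral_const_mul' _ _ (ENNReal.mul_ne_top ENNReal.ofNat_ne_top ENNReal.ofReal_ne_top)]
  gcongr
  refine (setLIntegral_le_lintegral _ _).trans ?_
  rw [lintegral_add_right_eq_self (fun x => ∫⁻ y, S.indicator u (x, y)) T,
    ← lintegral_prod _ (hu.indicator hS).aemeasurable, ← Measure.volume_eq_prod,
    lintegral_indicator hS]

lemma lintegral_average_le {α β γ δ : Type*} [MeasurableSpace α] [MeasurableSpace β]
    [MeasurableSpace γ] [MeasurableSpace δ] {μ : Measure α} {ν : Measure β} {ρ : Measure γ}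
    {σ : Measure δ} [SFinite μ] [SFinite ν] [IsProbabilityMeasure ρ] [IsProbabilityMeasure σ]
    {w : α → β → γ → δ → ℝ≥0∞}
    (hw : Measurable fun z : (α × β) × (γ × δ) => w z.1.1 z.1.2 z.2.1 z.2.2)
    {M : ℝ≥0∞} (hM : ∀ c d, ∫⁻ a, ∫⁻ b, w a b c d ∂ν ∂μ ≤ M) :
    ∫⁻ a, ∫⁻ b, ∫⁻ c, ∫⁻ d, w a b c d ∂σ ∂ρ ∂ν ∂μ ≤ M := by
  have h1 : ∀ a b, ∫⁻ c, ∫⁻ d, w a b c d ∂σ ∂ρ = ∫⁻ y, w a b y.1 y.2 ∂(ρ.prod σ) := fun a b =>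
    lintegral_lintegral (f := w a b) (hw.comp (measurable_prodMk_left (x := (a, b)))).aemeasurable
  have h2 : ∫⁻ a, ∫⁻ b, ∫⁻ c, ∫⁻ d, w a b c d ∂σ ∂ρ ∂ν ∂μ =
      ∫⁻ x, ∫⁻ y, w x.1 x.2 y.1 y.2 ∂(ρ.prod σ) ∂(μ.prod ν) := by
    simp only [h1]
    exact lintegral_lintegral (f := fun a b => ∫⁻ y, w a b y.1 y.2 ∂(ρ.prod σ))
      hw.lintegral_prod_right'.aemeasurable
  rw [h2, lintegral_lintegral_swap hw.aemeasurable]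
  have h3 : ∀ y : γ × δ, ∫⁻ x, w x.1 x.2 y.1 y.2 ∂(μ.prod ν) ≤ M := fun y => by
    rw [lintegral_prod (fun x : α × β => w x.1 x.2 y.1 y.2)
      (hw.comp (measurable_prodMk_right (y := y))).aemeasurable]
    exact hM y.1 y.2
  calc _ ≤ ∫⁻ _, M ∂(ρ.prod σ) := lintegral_mono h3
    _ = M := by simp

lemma continuous_eval_prod (P : MvPolynomial (Fin 2) ℝ) :
    Continuous fun q : ℝ × ℝ => MvPolynomial.eval ![q.1, q.2] P :=
  (MvPolynomial.continuous_eval P).comp (by fun_prop)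

lemma IsPoly2.continuous {n : ℕ} {f : ℝ × ℝ → ℝ} (hf : IsPoly2 n f) : Continuous f := by
  obtain ⟨P, -, hP⟩ := hf
  rw [funext hP]
  exact continuous_eval_prod P

lemma continuous_Dtan_iterate_pd2 {g : ℝ → ℝ} (hg' : Continuous (deriv g)) (r m : ℕ) {n : ℕ}
    {f : ℝ × ℝ → ℝ} (hf : IsPoly2 n f) : Continuous (Dtan g r (pd2^[m] f)) := by
  obtain ⟨P, -, hP⟩ := hf
  obtain rfl := funext hP
  rw [iterate_pd2_eval]
  have h (Q : MvPolynomial (Fin 2) ℝ) : Dtan g r (fun q => MvPolynomial.eval ![q.1, q.2] Q) =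
      fun q => ∑ i ∈ Finset.range (r + 1), (r.choose i : ℝ) * deriv g q.1 ^ i *
        (pd1^[r - i] (pd2^[i] fun q => MvPolynomial.eval ![q.1, q.2] Q)) q := rfl
  rw [h]
  simp only [iterate_pd2_eval, iterate_pd1_eval]
  refine continuous_finsetSum _ fun i _ => ?_
  exact (continuous_const.mul ((hg'.comp continuous_fst).pow i)).mul (continuous_eval_prod _)

lemma continuous_phi2 {g : ℝ → ℝ} (hg : Continuous g) (n : ℕ) : Continuous (phi2 g n) := by
  unfold phi2
  fun_prop

lemma isProbabilityMeasure_angleMeasure {N : ℕ} (hN : 0 < N) :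
    IsProbabilityMeasure (angleMeasure N) := ⟨angleMeasure_univ hN⟩

lemma exists_lintegral_bernstein {a L : ℝ} (ha : 0 < a) (hL : 0 < L) {g : ℝ → ℝ}
    (hg : ContDiff ℝ 2 g) {p : ℝ} (hp : 0 < p) {lam : ℝ} (hlam : 1 < lam) (r i j : ℕ) :
    ∃ C : ℝ, 0 < C ∧ ∀ n : ℕ, 0 < n → ∀ f : ℝ × ℝ → ℝ, IsPoly2 n f →
      ∫⁻ q in Gset a L g 1, ENNReal.ofReal (|phi2 g n q ^ i * Dtan g r (pd2^[i + j] f) q| ^ p) ≤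
        ENNReal.ofReal (C * ((n : ℝ) ^ (r + i + 2 * j)) ^ p) *
          ∫⁻ q in Gset a L g lam, ENNReal.ofReal (|f q| ^ p) := by
  have hgc := hg.continuous
  have hgc' : Continuous (deriv g) := hg.continuous_deriv one_le_two
  obtain ⟨A, δ, ℓ, hA, hδ, hℓ, hmem⟩ := exists_parabolaPoint_mem_Gset ha hL hg hlam
  have hLa : 0 < L * a := mul_pos hL ha
  have hℓ0 : 0 < ℓ := hLa.trans hℓ
  obtain ⟨C, hC, H⟩ := exists_pointwise_bernstein hℓ0 hLa.le hℓ hA hδ hp (e := 1) le_rfl r i j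
  refine ⟨ℓ / 2 * C * (2 * (2 / ℓ)), by positivity, fun n hn f hf => ?_⟩
  have hfc := hf.continuous
  have := isProbabilityMeasure_angleMeasure (N := 2 * n) (by positivity)
  have := isProbabilityMeasure_angleMeasure (N := 2 * (2 * n)) (by positivity)
  set F := fun q => phi2 g n q ^ i * Dtan g r (pd2^[i + j] f) q with hF
  have hFc : Continuous F :=
    ((continuous_phi2 hgc n).pow i).mul (continuous_Dtan_iterate_pd2 hgc' r (i + j) hf)
  set u : ℝ × ℝ → ℝ≥0∞ := fun q => ENNReal.ofReal (|f q| ^ p) with hu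
  have huc : Continuous u := ENNReal.continuous_ofReal.comp (hfc.abs.rpow_const fun _ => Or.inr hp.le)
  set w : ℝ → ℝ → ℝ → ℝ → ℝ≥0∞ := fun x θ β τ => ENNReal.ofReal |Real.sin (θ + β)| *
    u (parabolaPoint g A ℓ x (δ * Real.cos (Real.pi / 2 + τ)) (Real.cos (θ + β))) with hw
  have hwm : Measurable fun z : (ℝ × ℝ) × (ℝ × ℝ) => w z.1.1 z.1.2 z.2.1 z.2.2 := by
    refine Measurable.mul (by fun_prop) (huc.measurable.comp (Continuous.measurable ?_))
    unfold parabolaPoint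
    fun_prop
  set K := ENNReal.ofReal (C * ((n : ℝ) ^ (r + i + 2 * j)) ^ p)
  have hpt : ∀ x, ∫⁻ y in Ioc (g x - L * a) (g x), ENNReal.ofReal (|F (x, y)| ^ p) ≤
      ENNReal.ofReal (ℓ / 2) * (K * ∫⁻ θ in Icc 0 Real.pi, ∫⁻ β, ∫⁻ τ, w x θ β τ
        ∂angleMeasure (2 * (2 * n)) ∂angleMeasure (2 * n)) := by
    intro x
    refine (lintegral_Ioc_le_lintegral_cos hℓ0 hℓ.le (g x) _).trans ?_
    rw [← lintegral_const_mul' K _ ENNReal.ofReal_ne_top]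
    refine mul_le_mul_right ?_ _
    refine setLIntegral_mono' measurableSet_Icc fun θ hθ => ?_
    by_cases hy : g x - ℓ * (1 - Real.cos θ) / 2 ∈ Ioc (g x - L * a) (g x)
    · rw [indicator_of_mem hy]
      have h1 := H g n hn f hf (x, g x - ℓ * (1 - Real.cos θ) / 2)
        ⟨by linarith [hy.2], by linarith [hy.1]⟩
      have h2 : 1 - 2 * (g x - (g x - ℓ * (1 - Real.cos θ) / 2)) / ℓ = Real.cos θ := by
        field_simp
        ring
      simp only [h2, Real.arccos_cos hθ.1 hθ.2, pow_one] at h1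
      rw [mul_comm, ← ENNReal.ofReal_mul (by positivity)]
      refine h1.trans (le_of_eq ?_)
      congr! 5 with β τ
      rw [mul_comm, ENNReal.ofReal_mul (abs_nonneg _)]
    · simp [indicator_of_notMem hy]
  have hav := lintegral_average_le (μ := volume.restrict (Ioo (-a) a))
    (ν := volume.restrict (Icc 0 Real.pi)) (ρ := angleMeasure (2 * n))
    (σ := angleMeasure (2 * (2 * n))) hwm (fun β τ => lintegral_parabolaPoint_le hℓ0
      (measurableSet_Gset a L hgc lam) (fun x hx c hc => hmem x hx _ (by
        rw [abs_mul, abs_of_pos hδ]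
        exact mul_le_of_le_one_right hδ.le (Real.abs_cos_le_one _)) c hc) huc.measurable β)
  have hFm : Measurable fun q => ENNReal.ofReal (|F q| ^ p) := by fun_prop
  rw [lintegral_Gset a L hgc 1 hFm]
  simp only [one_mul]
  refine (lintegral_mono hpt).trans ?_
  rw [lintegral_const_mul' _ _ ENNReal.ofReal_ne_top, lintegral_const_mul' _ _ ENNReal.ofReal_ne_top]
  refine (mul_le_mul_right (mul_le_mul_right hav _) _).trans (le_of_eq ?_)
  rw [← mul_assoc, ← mul_assoc, ← ENNReal.ofReal_mul (by positivity),
    ← ENNReal.ofReal_ofNat 2, ← ENNReal.ofReal_mul (by positivity),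
    ← ENNReal.ofReal_mul (by positivity)]
  congr 2
  ring

lemma enorm_le_eLpNorm_top_Gset {a L : ℝ} {g : ℝ → ℝ} (hg : Continuous g) {lam : ℝ}
    {f : ℝ × ℝ → ℝ} (hf : Continuous f) {q : ℝ × ℝ} (hq : q ∈ Gset a L g lam) :
    ‖f q‖ₑ ≤ eLpNorm f ∞ (volume.restrict (Gset a L g lam)) := by
  set M := eLpNorm f ∞ (volume.restrict (Gset a L g lam)) with hM
  set U := {z : ℝ × ℝ | z.1 ∈ Ioo (-(lam * a)) (lam * a) ∧ g z.1 - lam * L * a < z.2 ∧ z.2 < g z.1}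
    with hU
  have hUo : IsOpen U := by
    have h1 : IsOpen {z : ℝ × ℝ | g z.1 - lam * L * a < z.2} := isOpen_lt (by fun_prop) (by fun_prop)
    have h2 : IsOpen {z : ℝ × ℝ | z.2 < g z.1} := isOpen_lt (by fun_prop) (by fun_prop)
    exact (isOpen_Ioo.preimage continuous_fst).inter (h1.inter h2)
  have hUG : U ⊆ Gset a L g lam := fun z hz => ⟨hz.1, hz.2.1, hz.2.2.le⟩
  have hVo : IsOpen (U ∩ {z | M < ‖f z‖ₑ}) :=
    hUo.inter (isOpen_lt continuous_const hf.enorm)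
  have hV0 : volume (U ∩ {z | M < ‖f z‖ₑ}) = 0 := by
    have h1 : ∀ᵐ z ∂volume.restrict (Gset a L g lam), ‖f z‖ₑ ≤ M := by
      rw [hM, eLpNorm_exponent_top]
      exact enorm_ae_le_eLpNormEssSup f _
    have h2 := (ae_restrict_iff' (measurableSet_Gset a L hg lam)).1 h1
    refine measure_mono_null (fun z hz => ?_) (ae_iff.1 h2)
    exact fun h => (h (hUG hz.1)).not_gt hz.2
  have hV := hVo.measure_eq_zero_iff volume |>.1 hV0
  have hUM : U ⊆ {z | ‖f z‖ₑ ≤ M} := fun z hz => by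
    rw [mem_ofPred_eq]
    exact le_of_not_gt fun h => eq_empty_iff_forall_notMem.1 hV z ⟨hz, h⟩
  have hcl : q ∈ closure U := by
    have ht : Filter.Tendsto (fun t : ℝ => (q.1, q.2 - t)) (nhdsWithin 0 (Ioi 0)) (nhds q) := by
      have : Continuous fun t : ℝ => (q.1, q.2 - t) := by fun_prop
      simpa using (this.tendsto 0).mono_left nhdsWithin_le_nhds
    refine mem_closure_of_tendsto ht ?_
    filter_upwards [Ioo_mem_nhdsGT (sub_pos.2 hq.2.1)] with t ht
    refine ⟨hq.1, ?_, ?_⟩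
    · have := ht.2
      simp only
      linarith
    · have := ht.1
      have := hq.2.2
      simp only
      linarith
  exact closure_minimal hUM (isClosed_le hf.enorm continuous_const) hcl

lemma exists_eLpNorm_top_bernstein {a L : ℝ} (ha : 0 < a) (hL : 0 < L) {g : ℝ → ℝ}
    (hg : ContDiff ℝ 2 g) {lam : ℝ} (hlam : 1 < lam) (r i j : ℕ) :
    ∃ C : ℝ, 0 < C ∧ ∀ n : ℕ, 0 < n → ∀ f : ℝ × ℝ → ℝ, IsPoly2 n f →
      eLpNorm (fun q => phi2 g n q ^ i * Dtan g r (pd2^[i + j] f) q) ∞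
          (volume.restrict (Gset a L g 1)) ≤
        ENNReal.ofReal (C * (n : ℝ) ^ (r + i + 2 * j)) *
          eLpNorm f ∞ (volume.restrict (Gset a L g lam)) := by
  obtain ⟨A, δ, ℓ, hA, hδ, hℓ, hmem⟩ := exists_parabolaPoint_mem_Gset ha hL hg hlam
  have hLa : 0 < L * a := mul_pos hL ha
  obtain ⟨C, hC, H⟩ := exists_pointwise_bernstein (hLa.trans hℓ) hLa.le hℓ hA hδ one_pos
    (Nat.zero_le 1) r i j
  refine ⟨C, hC, fun n hn f hf => ?_⟩
  have := isProbabilityMeasure_angleMeasure (N := 2 * n) (by positivity)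
  have := isProbabilityMeasure_angleMeasure (N := 2 * (2 * n)) (by positivity)
  rw [eLpNorm_exponent_top]
  refine essSup_le_of_ae_le _ ?_
  filter_upwards [ae_restrict_mem (measurableSet_Gset a L hg.continuous 1)] with q hq
  obtain ⟨hq1, hq2, hq3⟩ := hq
  simp only [one_mul] at hq1 hq2
  have h1 := H g n hn f hf q ⟨by linarith, by linarith⟩
  simp only [Real.rpow_one, pow_zero, mul_one] at h1
  rw [← ofReal_norm, Real.norm_eq_abs]
  refine h1.trans (mul_le_mul_right ?_ _)
  calc _ ≤ ∫⁻ _ : ℝ, ∫⁻ _ : ℝ, eLpNorm f ∞ (volume.restrict (Gset a L g lam))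
        ∂angleMeasure (2 * (2 * n)) ∂angleMeasure (2 * n) := by
        refine lintegral_mono fun β => lintegral_mono fun τ => ?_
        rw [← Real.norm_eq_abs, ofReal_norm]
        refine enorm_le_eLpNorm_top_Gset hg.continuous hf.continuous (hmem _ hq1 _ ?_ _
          (Real.cos_mem_Icc _))
        rw [abs_mul, abs_of_pos hδ]
        exact mul_le_of_le_one_right hδ.le (Real.abs_cos_le_one _)
    _ = _ := by simp

lemma exists_eLpNorm_bernstein {a L : ℝ} (ha : 0 < a) (hL : 0 < L) {g : ℝ → ℝ}
    (hg : ContDiff ℝ 2 g) {p : ℝ≥0∞} (hp : p ≠ 0) (hp' : p ≠ ∞) {lam : ℝ} (hlam : 1 < lam)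
    (r i j : ℕ) :
    ∃ C : ℝ, 0 < C ∧ ∀ n : ℕ, 0 < n → ∀ f : ℝ × ℝ → ℝ, IsPoly2 n f →
      eLpNorm (fun q => phi2 g n q ^ i * Dtan g r (pd2^[i + j] f) q) p
          (volume.restrict (Gset a L g 1)) ≤
        ENNReal.ofReal (C * (n : ℝ) ^ (r + i + 2 * j)) *
          eLpNorm f p (volume.restrict (Gset a L g lam)) := by
  have hp0 : 0 < p.toReal := ENNReal.toReal_pos hp hp'
  obtain ⟨C, hC, H⟩ := exists_lintegral_bernstein ha hL hg hp0 hlam r i j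
  refine ⟨C ^ (1 / p.toReal), by positivity, fun n hn f hf => ?_⟩
  have h1 : ∀ y : ℝ, ‖y‖ₑ ^ p.toReal = ENNReal.ofReal (|y| ^ p.toReal) := fun y => by
    rw [← ofReal_norm, Real.norm_eq_abs, ENNReal.ofReal_rpow_of_nonneg (abs_nonneg _) hp0.le]
  rw [eLpNorm_eq_lintegral_rpow_enorm_toReal hp hp', eLpNorm_eq_lintegral_rpow_enorm_toReal hp hp']
  simp only [h1]
  refine (ENNReal.rpow_le_rpow (H n hn f hf) (by positivity)).trans (le_of_eq ?_)
  rw [ENNReal.mul_rpow_of_nonneg _ _ (by positivity),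
    ENNReal.ofReal_rpow_of_nonneg (by positivity) (by positivity),
    Real.mul_rpow hC.le (by positivity), ← Real.rpow_mul (by positivity),
    mul_one_div_cancel hp0.ne', Real.rpow_one]

/-- **Theorem 4.1** (Bernstein type inequality on domains of special type in `ℝ²`):
`‖φ_n^i D^{(r)} ∂₂^{i+j} f‖_{L^p(G)} ≤ c n^{r+i+2j} ‖f‖_{L^p(G(λ))}` for all `f ∈ Π_n²`. -/
theorem bernstein_special_2d (a L : ℝ) (ha : 0 < a) (hL : 1 ≤ L)
    (g : ℝ → ℝ) (hg : ContDiff ℝ 2 g)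
    -- `min_{x∈[−2a,2a]} g(x) = 4La`:
    (hgmin₁ : ∀ x ∈ Icc (-(2 * a)) (2 * a), 4 * L * a ≤ g x)
    (hgmin₂ : ∃ x ∈ Icc (-(2 * a)) (2 * a), g x = 4 * L * a)
    (p : ℝ≥0∞) (hp : 0 < p) (lam : ℝ) (hlam : 1 < lam) (r i j : ℕ) :
    ∃ c : ℝ, 0 < c ∧ ∀ (n : ℕ), 0 < n → ∀ f : ℝ × ℝ → ℝ, IsPoly2 n f →
      eLpNorm (fun q => phi2 g n q ^ i * Dtan g r (pd2^[i + j] f) q) p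
          (volume.restrict (Gset a L g 1))
        ≤ ENNReal.ofReal (c * (n : ℝ) ^ (r + i + 2 * j)) *
            eLpNorm f p (volume.restrict (Gset a L g lam)) := by
  have hL0 : 0 < L := one_pos.trans_le hL
  rcases eq_or_ne p ∞ with rfl | hp'
  · exact exists_eLpNorm_top_bernstein ha hL0 hg hlam r i j
  · exact exists_eLpNorm_bernstein ha hL0 hg hp.ne' hp' hlam r i j
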